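/- arXiv:2109.04625 — 7 statements merged into one kernel-verified Lean document; each statement's English description precedes it below -/
import Mathlib

section
/- Let n be a positive integer. The set B_n of integer-valued functions on the divisors of n satisfying the Cauchy–Frobenius–Burnside congruences is a subring of the product ring ∏_{m ∣ n} ℤ with pointwise operations: B_n contains the constant function 1 and is closed under pointwise addition, negation, and pointwise multiplication. -/
open Finset

/-- If `d ∣ n` and `e ∣ d`, then `(n / d) * e` is a divisor of `n`. -/
theorem divMulMem (n d e : ℕ) (hd : d ∈ n.divisors) (he : e ∈ d.divisors) :
    n / d * e ∈ n.divisors := by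
  rw [Nat.mem_divisors] at hd ⊢
  refine ⟨?_, hd.2⟩
  calc n / d * e ∣ n / d * d := mul_dvd_mul_left _ (Nat.mem_divisors.mp he).1
    _ = n := Nat.div_mul_cancel hd.1

/-- The set `B_n` of integer-valued functions on the divisors of `n` satisfying the
Cauchy–Frobenius–Burnside congruences. -/
def BurnsideSet (n : ℕ) : Set ({m : ℕ // m ∈ n.divisors} → ℤ) :=
  {x | ∀ d : ℕ, ∀ hd : d ∈ n.divisors,
    (d : ℤ) ∣ ∑ e ∈ d.divisors.attach,
      (Nat.totient e.1 : ℤ) * x ⟨n / d * e.1, divMulMem n d e.1 hd e.2⟩}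

section DoldCongruences

open scoped ArithmeticFunction.zeta ArithmeticFunction.Moebius

/-- Euler's totient function as an integer-valued arithmetic function. -/
def intTotient : ArithmeticFunction ℤ :=
  ⟨fun k => (Nat.totient k : ℤ), by simp⟩

theorem intTotient_mul_zeta_apply (k : ℕ) :
    (intTotient * (ζ : ArithmeticFunction ℤ)) k = k := by
  rw [ArithmeticFunction.coe_mul_zeta_apply]
  change ∑ i ∈ k.divisors, (Nat.totient i : ℤ) = k
  exact_mod_cast Nat.sum_totient k

/-- The Burnside congruences for `ζ * H` at the divisors of `n` say that each `d ∣ n`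
divides `H d`. -/
theorem dvd_intTotient_mul_zeta_mul_iff (n : ℕ) (hn : n ≠ 0) (H : ArithmeticFunction ℤ) :
    (∀ d ∈ n.divisors, (d : ℤ) ∣ (intTotient * (ζ * H)) d) ↔
      ∀ d ∈ n.divisors, (d : ℤ) ∣ H d := by
  have expand (d : ℕ) : (intTotient * (ζ * H)) d =
      ∑ p ∈ d.divisorsAntidiagonal, (p.1 : ℤ) * H p.2 := by
    rw [← mul_assoc, ArithmeticFunction.mul_apply]
    simp only [intTotient_mul_zeta_apply]
  have term_dvd {d : ℕ} {p : ℕ × ℕ} (hp : p ∈ d.divisorsAntidiagonal)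
      (h : (p.2 : ℤ) ∣ H p.2) : (d : ℤ) ∣ (p.1 : ℤ) * H p.2 := by
    rw [← (Nat.mem_divisorsAntidiagonal.mp hp).1, Nat.cast_mul]
    exact mul_dvd_mul_left _ h
  constructor
  · intro h d
    induction d using Nat.strong_induction_on with
    | _ d ih =>
      intro hd
      have hdn := Nat.dvd_of_mem_divisors hd
      have hd0 : d ≠ 0 := (Nat.pos_of_mem_divisors hd).ne'
      have hmem : (1, d) ∈ d.divisorsAntidiagonal := by simp [hd0]
      have hsum := h d hd
      rw [expand, ← Finset.add_sum_erase _ _ hmem] at hsum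
      have hrest : (d : ℤ) ∣
          ∑ p ∈ d.divisorsAntidiagonal.erase (1, d), (p.1 : ℤ) * H p.2 := by
        refine Finset.dvd_sum fun p hp => ?_
        obtain ⟨hne, hp⟩ := Finset.mem_erase.mp hp
        have hpd : p.2 ∣ d := Nat.dvd_of_mem_divisors (Nat.snd_mem_divisors_of_mem_antidiagonal hp)
        refine term_dvd hp (ih p.2 ?_ (Nat.mem_divisors.mpr ⟨hpd.trans hdn, hn⟩))
        refine lt_of_le_of_ne (Nat.le_of_dvd (Nat.pos_of_ne_zero hd0) hpd) fun heq => hne ?_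
        have hmul := (Nat.mem_divisorsAntidiagonal.mp hp).1
        rw [heq] at hmul
        exact Prod.ext (Nat.eq_of_mul_eq_mul_right (Nat.pos_of_ne_zero hd0) (by simpa using hmul))
          heq
      simpa using (dvd_add_left hrest).mp hsum
  · intro h d hd
    rw [expand]
    refine Finset.dvd_sum fun p hp => term_dvd hp (h _ ?_)
    exact Nat.mem_divisors.mpr ⟨(Nat.dvd_of_mem_divisors
      (Nat.snd_mem_divisors_of_mem_antidiagonal hp)).trans (Nat.dvd_of_mem_divisors hd), hn⟩

/-- The convolution of arithmetic functions along the least common multiple. -/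
def lcmConvolution (H K : ArithmeticFunction ℤ) : ArithmeticFunction ℤ :=
  ⟨fun m => ∑ p ∈ m.divisors ×ˢ m.divisors with p.1.lcm p.2 = m, H p.1 * K p.2, by simp⟩

theorem zeta_mul_lcmConvolution (H K : ArithmeticFunction ℤ) :
    ζ * lcmConvolution H K =
      ArithmeticFunction.pmul ((ζ : ArithmeticFunction ℤ) * H) (ζ * K) := by
  ext d
  rcases eq_or_ne d 0 with rfl | hd
  · simp
  simp only [ArithmeticFunction.pmul_apply, ArithmeticFunction.coe_zeta_mul_apply]
  rw [Finset.sum_mul_sum, ← Finset.sum_product',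
    ← Finset.sum_fiberwise_of_maps_to (s := d.divisors ×ˢ d.divisors) (t := d.divisors)
      (g := fun p => p.1.lcm p.2)]
  · refine Finset.sum_congr rfl fun m hm => ?_
    refine Finset.sum_congr ?_ fun _ _ => rfl
    have hmd := Nat.dvd_of_mem_divisors hm
    have hm0 : m ≠ 0 := (Nat.pos_of_mem_divisors hm).ne'
    ext ⟨k, l⟩
    simp only [Finset.mem_filter, Finset.mem_product, Nat.mem_divisors]
    constructor
    · rintro ⟨⟨⟨hk, -⟩, hl, -⟩, h⟩
      exact ⟨⟨⟨hk.trans hmd, hd⟩, hl.trans hmd, hd⟩, h⟩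
    · rintro ⟨-, h⟩
      exact ⟨⟨⟨h ▸ Nat.dvd_lcm_left k l, hm0⟩, h ▸ Nat.dvd_lcm_right k l, hm0⟩, h⟩
  · rintro ⟨k, l⟩ hp
    simp only [Finset.mem_product, Nat.mem_divisors] at hp ⊢
    exact ⟨Nat.lcm_dvd hp.1.1 hp.2.1, hd⟩

theorem dvd_lcmConvolution (n : ℕ) (H K : ArithmeticFunction ℤ)
    (hH : ∀ d ∈ n.divisors, (d : ℤ) ∣ H d) (hK : ∀ d ∈ n.divisors, (d : ℤ) ∣ K d) :
    ∀ d ∈ n.divisors, (d : ℤ) ∣ lcmConvolution H K d := by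
  intro d hd
  refine Finset.dvd_sum fun p hp => ?_
  obtain ⟨hp, hlcm⟩ := Finset.mem_filter.mp hp
  obtain ⟨h₁, h₂⟩ := Finset.mem_product.mp hp
  have hsub := Nat.divisors_subset_of_dvd (Nat.mem_divisors.mp hd).2 (Nat.mem_divisors.mp hd).1
  calc (d : ℤ) ∣ (p.1 : ℤ) * p.2 := by
        rw [← hlcm]
        exact_mod_cast Nat.lcm_dvd_mul p.1 p.2
    _ ∣ H p.1 * K p.2 := mul_dvd_mul (hH _ (hsub h₁)) (hK _ (hsub h₂))

theorem dvd_intTotient_mul_pmul (n : ℕ) (hn : n ≠ 0) (F G : ArithmeticFunction ℤ)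
    (hF : ∀ d ∈ n.divisors, (d : ℤ) ∣ (intTotient * F) d)
    (hG : ∀ d ∈ n.divisors, (d : ℤ) ∣ (intTotient * G) d) :
    ∀ d ∈ n.divisors, (d : ℤ) ∣ (intTotient * ArithmeticFunction.pmul F G) d := by
  have inversion (F : ArithmeticFunction ℤ) : F = ζ * (μ * F) := by
    rw [← mul_assoc, ArithmeticFunction.coe_zeta_mul_moebius, one_mul]
  rw [inversion F, dvd_intTotient_mul_zeta_mul_iff n hn] at hF
  rw [inversion G, dvd_intTotient_mul_zeta_mul_iff n hn] at hG
  rw [inversion F, inversion G, ← zeta_mul_lcmConvolution, dvd_intTotient_mul_zeta_mul_iff n hn]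
  exact dvd_lcmConvolution n _ _ hF hG

/-- The arithmetic function `k ↦ x (n / k)` on the divisors of `n`, extended by zero. -/
def codivisorExtension (n : ℕ) (x : {m : ℕ // m ∈ n.divisors} → ℤ) : ArithmeticFunction ℤ :=
  ⟨fun k => if h : k ∈ n.divisors then
      x ⟨n / k, Nat.mem_divisors.mpr
        ⟨Nat.div_dvd_of_dvd (Nat.dvd_of_mem_divisors h), (Nat.mem_divisors.mp h).2⟩⟩
    else 0, by simp⟩

theorem codivisorExtension_apply (n : ℕ) (x : {m : ℕ // m ∈ n.divisors} → ℤ) (k : ℕ) :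
    codivisorExtension n x k = if h : k ∈ n.divisors then
      x ⟨n / k, Nat.mem_divisors.mpr
        ⟨Nat.div_dvd_of_dvd (Nat.dvd_of_mem_divisors h), (Nat.mem_divisors.mp h).2⟩⟩
    else 0 := rfl

theorem codivisorExtension_mul (n : ℕ) (x y : {m : ℕ // m ∈ n.divisors} → ℤ) :
    codivisorExtension n (x * y) =
      ArithmeticFunction.pmul (codivisorExtension n x) (codivisorExtension n y) := by
  ext k
  simp only [ArithmeticFunction.pmul_apply, codivisorExtension_apply]
  split_ifs <;> simp

theorem mem_burnsideSet_iff (n : ℕ) (x : {m : ℕ // m ∈ n.divisors} → ℤ) :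
    x ∈ BurnsideSet n ↔
      ∀ d ∈ n.divisors, (d : ℤ) ∣ (intTotient * codivisorExtension n x) d := by
  refine forall₂_congr fun d hd => ?_
  rw [ArithmeticFunction.mul_apply,
    Nat.sum_divisorsAntidiagonal fun a b => intTotient a * codivisorExtension n x b,
    ← Finset.sum_attach d.divisors]
  refine iff_of_eq (congrArg _ (Finset.sum_congr rfl fun e _ => ?_))
  obtain ⟨hdn, hn⟩ := Nat.mem_divisors.mp hd
  have hed := Nat.dvd_of_mem_divisors e.2
  have hmem : d / e.1 ∈ n.divisors :=
    Nat.mem_divisors.mpr ⟨(Nat.div_dvd_of_dvd hed).trans hdn, hn⟩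
  have hdiv : n / d * e.1 = n / (d / e.1) := by
    refine (Nat.div_eq_of_eq_mul_left (Nat.pos_of_mem_divisors hmem) ?_).symm
    rw [mul_assoc, Nat.mul_div_cancel' hed, Nat.div_mul_cancel hdn]
  rw [codivisorExtension_apply, dif_pos hmem]
  simp only [hdiv]
  rfl

end DoldCongruences

/-- For a positive integer `n`, the set `B_n` of integer-valued functions on
the divisors of `n` satisfying the Cauchy–Frobenius–Burnside congruences is a subring of the
product ring `∏_{m ∣ n} ℤ` with pointwise operations: it contains the constant function `1`
and is closed under pointwise addition, negation, and pointwise multiplication. -/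
theorem burnsideSet_isSubring (n : ℕ) (hn : 0 < n) :
    (1 : {m : ℕ // m ∈ n.divisors} → ℤ) ∈ BurnsideSet n ∧
    (∀ x y, x ∈ BurnsideSet n → y ∈ BurnsideSet n → x + y ∈ BurnsideSet n) ∧
    (∀ x, x ∈ BurnsideSet n → -x ∈ BurnsideSet n) ∧
    (∀ x y, x ∈ BurnsideSet n → y ∈ BurnsideSet n → x * y ∈ BurnsideSet n) := by
  refine ⟨fun d hd => ?_, fun x y hx hy d hd => ?_, fun x hx d hd => ?_, fun x y hx hy => ?_⟩
  · simp only [Pi.one_apply, mul_one]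
    rw [Finset.sum_attach d.divisors fun e => (Nat.totient e : ℤ)]
    exact_mod_cast (Nat.sum_totient d).symm.dvd
  · simp only [Pi.add_apply, mul_add, Finset.sum_add_distrib]
    exact dvd_add (hx d hd) (hy d hd)
  · simp only [Pi.neg_apply, mul_neg, Finset.sum_neg_distrib]
    exact (dvd_neg).mpr (hx d hd)
  · rw [mem_burnsideSet_iff] at hx hy ⊢
    rw [codivisorExtension_mul]
    exact dvd_intTotient_mul_pmul n hn.ne' _ _ hx hy
end

section
/- Let n be a positive integer. The mark vectors {v_q : q ∣ n} form a basis of B_n as a ℤ-module: they are ℤ-linearly independent, and their ℤ-span is exactly the set of integer-valued functions on the divisors of n satisfying the Cauchy–Frobenius–Burnside congruences. In particular, B_n is a free abelian group of rank equal to the number of divisors of n. -/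
open Finset

/-- The mark vector `v_q` of the transitive `C_n`-set `C_n/C_{n/q}`: its value at a divisor
`m` of `n` is `q` if `m ∣ n/q` and `0` otherwise. -/
def markVector (n : ℕ) (q : {m : ℕ // m ∈ n.divisors}) : {m : ℕ // m ∈ n.divisors} → ℤ :=
  fun m => if (m : ℕ) ∣ n / (q : ℕ) then (q : ℤ) else 0

/-- The `d`-th Cauchy–Frobenius–Burnside sum, as a linear functional. -/
def burnsideSum (n : ℕ) (d : {m : ℕ // m ∈ n.divisors}) :
    ({m : ℕ // m ∈ n.divisors} → ℤ) →ₗ[ℤ] ℤ :=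
  ∑ e ∈ d.1.divisors.attach,
    (Nat.totient e.1 : ℤ) • LinearMap.proj ⟨n / d * e.1, divMulMem n d e.1 d.2 e.2⟩

theorem burnsideSum_apply (n : ℕ) (d : {m : ℕ // m ∈ n.divisors})
    (x : {m : ℕ // m ∈ n.divisors} → ℤ) :
    burnsideSum n d x = ∑ e ∈ d.1.divisors.attach,
      (Nat.totient e.1 : ℤ) * x ⟨n / d * e.1, divMulMem n d e.1 d.2 e.2⟩ := by
  simp [burnsideSum, LinearMap.sum_apply]

theorem mem_BurnsideSet_iff (n : ℕ) (x : {m : ℕ // m ∈ n.divisors} → ℤ) :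
    x ∈ BurnsideSet n ↔ ∀ d : {m : ℕ // m ∈ n.divisors}, (d.1 : ℤ) ∣ burnsideSum n d x := by
  simp only [burnsideSum_apply, Subtype.forall]
  rfl

theorem div_mul_dvd_div_iff {n d q e : ℕ} (hn : 0 < n) (hd : d ∣ n) (hq : q ∣ n) :
    n / d * e ∣ n / q ↔ q * e ∣ d := by
  obtain ⟨a, rfl⟩ := hd
  have hd0 : 0 < d := Nat.pos_of_mul_pos_right hn
  have ha0 : 0 < a := Nat.pos_of_mul_pos_left hn
  have hq0 : 0 < q := Nat.pos_of_dvd_of_pos hq hn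
  rw [Nat.mul_div_cancel_left _ hd0, Nat.dvd_div_iff_mul_dvd hq,
    show q * (a * e) = (q * e) * a by ring, Nat.mul_dvd_mul_iff_right ha0]

/-- On the mark vectors the Burnside sums are given by the divisibility relation. -/
theorem burnsideSum_markVector (n : ℕ) (d q : {m : ℕ // m ∈ n.divisors}) :
    burnsideSum n d (markVector n q) = if q.1 ∣ d.1 then (d.1 : ℤ) else 0 := by
  obtain ⟨d, hd⟩ := d
  obtain ⟨q, hq⟩ := q
  have hn : 0 < n := Nat.pos_of_ne_zero (Nat.mem_divisors.mp hd).2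
  have hdn := Nat.dvd_of_mem_divisors hd
  have hqn := Nat.dvd_of_mem_divisors hq
  rw [burnsideSum_apply]
  simp only [markVector, div_mul_dvd_div_iff hn hdn hqn]
  rw [sum_attach d.divisors (fun e => (Nat.totient e : ℤ) * if q * e ∣ d then (q : ℤ) else 0)]
  split_ifs with h
  · obtain ⟨k, rfl⟩ := h
    have hqk : 0 < q * k := Nat.pos_of_dvd_of_pos hdn hn
    have hq0 : 0 < q := Nat.pos_of_mul_pos_right hqk
    have hk0 : k ≠ 0 := (Nat.pos_of_mul_pos_left hqk).ne'
    simp only [Nat.mul_dvd_mul_iff_left hq0, mul_ite, mul_zero]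
    rw [← sum_filter]
    have hfilter : (q * k).divisors.filter (· ∣ k) = k.divisors := by
      ext e
      simp only [mem_filter, Nat.mem_divisors]
      exact ⟨fun h => ⟨h.2, hk0⟩, fun h => ⟨⟨h.1.mul_left q, hqk.ne'⟩, h.1⟩⟩
    rw [hfilter, ← sum_mul, ← Nat.cast_sum, Nat.sum_totient]
    push_cast
    ring
  · exact sum_eq_zero fun e _ => by
      rw [if_neg fun he => h ((Dvd.intro _ rfl).trans he), mul_zero]

theorem eq_zero_of_burnsideSum_eq_zero (n : ℕ) (x : {m : ℕ // m ∈ n.divisors} → ℤ)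
    (h : ∀ d, burnsideSum n d x = 0) : x = 0 := by
  have key : ∀ d : ℕ, ∀ m : {m : ℕ // m ∈ n.divisors}, n / m = d → x m = 0 := by
    intro d
    induction d using Nat.strong_induction_on with
    | _ d ih =>
      rintro ⟨m, hm⟩ rfl
      obtain ⟨hmn, hn0⟩ := Nat.mem_divisors.mp hm
      have hm0 : 0 < m := Nat.pos_of_dvd_of_pos hmn (Nat.pos_of_ne_zero hn0)
      have hd : n / m ∈ n.divisors := Nat.mem_divisors.mpr ⟨Nat.div_dvd_of_dvd hmn, hn0⟩
      have hnm : 0 < n / m := Nat.pos_of_mem_divisors hd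
      have hs := h ⟨n / m, hd⟩
      rw [burnsideSum_apply, sum_eq_single ⟨1, Nat.one_mem_divisors.mpr hnm.ne'⟩] at hs
      · simpa [Nat.div_div_self hmn hn0] using hs
      · rintro ⟨e, he⟩ - hne
        have he0 : 0 < e := Nat.pos_of_mem_divisors he
        have he1 : 1 < e := lt_of_le_of_ne he0 fun h => hne (Subtype.ext h.symm)
        rw [ih _ _ _ rfl, mul_zero]
        simp only [Nat.div_div_self hmn hn0]
        rw [← Nat.div_div_eq_div_mul]
        exact Nat.div_lt_self hnm he1
      · exact fun h => absurd (mem_attach _ _) h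
  exact funext fun m => key _ m rfl

theorem burnsideSum_sum_smul_markVector (n : ℕ) (c : {m : ℕ // m ∈ n.divisors} → ℤ)
    (d : {m : ℕ // m ∈ n.divisors}) :
    burnsideSum n d (∑ q, c q • markVector n q) =
      d.1 * ∑ q, if q.1 ∣ d.1 then c q else 0 := by
  simp only [map_sum, map_smul, burnsideSum_markVector, mul_sum, smul_eq_mul, mul_ite, mul_zero]
  exact sum_congr rfl fun q _ => by split_ifs <;> ring

theorem linearIndependent_markVector (n : ℕ) : LinearIndependent ℤ (markVector n) := by
  rw [Fintype.linearIndependent_iff]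
  intro c hc
  have hsum (d : {m : ℕ // m ∈ n.divisors}) : ∑ q, (if q.1 ∣ d.1 then c q else 0) = 0 := by
    have h := burnsideSum_sum_smul_markVector n c d
    rw [hc, map_zero] at h
    have hd : (d.1 : ℤ) ≠ 0 := by exact_mod_cast (Nat.pos_of_mem_divisors d.2).ne'
    exact (mul_eq_zero.mp h.symm).resolve_left hd
  have key : ∀ k : ℕ, ∀ d : {m : ℕ // m ∈ n.divisors}, d.1 = k → c d = 0 := by
    intro k
    induction k using Nat.strong_induction_on with
    | _ k ih =>
      rintro d rfl
      have h := hsum d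
      rw [sum_eq_single d] at h
      · simpa using h
      · intro q _ hq
        split_ifs with hqd
        · exact ih q.1 (lt_of_le_of_ne (Nat.le_of_dvd (Nat.pos_of_mem_divisors d.2) hqd)
            fun h => hq (Subtype.ext h)) q rfl
        · rfl
      · exact fun h => absurd (mem_univ _) h
  exact fun d => key _ d rfl

theorem exists_sum_dvd_eq (n : ℕ) (y : {m : ℕ // m ∈ n.divisors} → ℤ) :
    ∃ c : {m : ℕ // m ∈ n.divisors} → ℤ, ∀ d, ∑ q, (if q.1 ∣ d.1 then c q else 0) = y d := by
  let g : ℕ → ℤ := fun d => if h : d ∈ n.divisors then y ⟨d, h⟩ else 0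
  let f : ℕ → ℤ := fun d => ∑ p ∈ d.divisorsAntidiagonal, (ArithmeticFunction.moebius p.1) * g p.2
  have hfg : ∀ d > 0, ∑ q ∈ d.divisors, f q = g d :=
    ArithmeticFunction.sum_eq_iff_sum_mul_moebius_eq.mpr fun d _ => by simp [f]
  refine ⟨fun q => f q.1, fun d => ?_⟩
  rw [sum_coe_sort n.divisors (fun q => if q ∣ d.1 then f q else 0), ← sum_filter]
  obtain ⟨hdn, hn⟩ := Nat.mem_divisors.mp d.2
  rw [Nat.divisors_filter_dvd_of_dvd hn hdn, hfg _ (Nat.pos_of_mem_divisors d.2)]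
  exact dif_pos d.2

theorem span_markVector (n : ℕ) :
    (Submodule.span ℤ (Set.range (markVector n)) : Set ({m : ℕ // m ∈ n.divisors} → ℤ)) =
      BurnsideSet n := by
  ext x
  rw [SetLike.mem_coe, Submodule.mem_span_range_iff_exists_fun, mem_BurnsideSet_iff]
  constructor
  · rintro ⟨c, rfl⟩ d
    rw [burnsideSum_sum_smul_markVector]
    exact dvd_mul_right _ _
  · intro h
    choose y hy using h
    obtain ⟨c, hc⟩ := exists_sum_dvd_eq n y
    refine ⟨c, sub_eq_zero.mp (eq_zero_of_burnsideSum_eq_zero n _ fun d => ?_)⟩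
    rw [map_sub, burnsideSum_sum_smul_markVector, hc, hy, sub_self]

/-- The mark vectors `{v_q : q ∣ n}` form a basis of `B_n` as a `ℤ`-module:
they are `ℤ`-linearly independent and their `ℤ`-span is exactly the set of integer-valued
functions on the divisors of `n` satisfying the Cauchy–Frobenius–Burnside congruences.
In particular `B_n` is free abelian of rank the number of divisors of `n`. -/
theorem markVectors_basis (n : ℕ) (hn : 0 < n) :
    LinearIndependent ℤ (markVector n) ∧
    (Submodule.span ℤ (Set.range (markVector n)) : Set ({m : ℕ // m ∈ n.divisors} → ℤ)) =
      BurnsideSet n ∧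
    Module.finrank ℤ (Submodule.span ℤ (Set.range (markVector n))) = n.divisors.card := by
  refine ⟨linearIndependent_markVector n, span_markVector n, ?_⟩
  rw [finrank_span_eq_card (linearIndependent_markVector n), Fintype.card_coe]
end

section
/- Let n be a positive integer. The quotient abelian group (∏_{m ∣ n} ℤ)/B_n is finite of order ∏_{q ∣ n} q (the product over all divisors q of n); in particular, every prime dividing the order of this quotient divides n, so the inclusion B_n ↪ ∏_{m ∣ n} ℤ becomes an isomorphism after inverting n. -/
open Finset

/-- The Dirichlet quotient of `y` by Euler's totient function: the function `g` with
`∑ e ∣ d, φ(d / e) g(e) = y(d)` for every `d ≠ 0`. -/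
def totientQuotient (y : ℕ → ℤ) (d : ℕ) : ℤ :=
  y d - ∑ e ∈ d.properDivisors.attach, (Nat.totient (d / e.1) : ℤ) * totientQuotient y e.1
termination_by d
decreasing_by exact (Nat.mem_properDivisors.1 e.2).2

theorem sum_totient_mul_totientQuotient (y : ℕ → ℤ) {d : ℕ} (hd : d ≠ 0) :
    ∑ e ∈ d.divisors, (Nat.totient e : ℤ) * totientQuotient y (d / e) = y d := by
  have hflip : ∑ e ∈ d.divisors, (Nat.totient e : ℤ) * totientQuotient y (d / e) =
      ∑ e ∈ d.divisors, (Nat.totient (d / e) : ℤ) * totientQuotient y e := by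
    rw [← Nat.sum_div_divisors d fun e => (Nat.totient e : ℤ) * totientQuotient y (d / e)]
    refine Finset.sum_congr rfl fun e he => ?_
    rw [Nat.div_div_self (Nat.dvd_of_mem_divisors he) hd]
  rw [hflip, ← Nat.insert_self_properDivisors hd,
    Finset.sum_insert Nat.self_notMem_properDivisors, Nat.div_self (Nat.pos_of_ne_zero hd),
    Nat.totient_one, totientQuotient.eq_1 y d,
    Finset.sum_attach d.properDivisors
      fun e => (Nat.totient (d / e) : ℤ) * totientQuotient y e]
  push_cast
  ring

/-- The homomorphism sending `x` to the residues modulo `d` of the sums appearing in the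
Cauchy–Frobenius–Burnside congruences. -/
def burnsideResidue (n : ℕ) :
    ({m : ℕ // m ∈ n.divisors} → ℤ) →+ ((d : {m : ℕ // m ∈ n.divisors}) → ZMod d.1) where
  toFun x d := ((∑ e ∈ d.1.divisors.attach,
    (Nat.totient e.1 : ℤ) * x ⟨n / d.1 * e.1, divMulMem n d.1 e.1 d.2 e.2⟩ : ℤ) : ZMod d.1)
  map_zero' := by
    ext d
    simp
  map_add' x y := by
    ext d
    simp [mul_add, Finset.sum_add_distrib]

theorem burnsideResidue_eq_zero_iff (n : ℕ) (x : {m : ℕ // m ∈ n.divisors} → ℤ) :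
    burnsideResidue n x = 0 ↔ x ∈ BurnsideSet n := by
  rw [funext_iff, Subtype.forall]
  exact forall₂_congr fun d hd => ZMod.intCast_zmod_eq_zero_iff_dvd _ d

theorem burnsideResidue_surjective (n : ℕ) : Function.Surjective (burnsideResidue n) := by
  intro z
  choose w hw using fun d => ZMod.intCast_surjective (z d)
  let y : ℕ → ℤ := fun d => if hd : d ∈ n.divisors then w ⟨d, hd⟩ else 0
  refine ⟨fun m => totientQuotient y (n / m.1), funext fun ⟨d, hd⟩ => ?_⟩
  rw [← hw]
  refine congrArg (Int.cast : ℤ → ZMod d) ?_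
  obtain ⟨hdn, hn⟩ := Nat.mem_divisors.1 hd
  have hd0 : d ≠ 0 := ne_zero_of_dvd_ne_zero hn hdn
  calc ∑ e ∈ d.divisors.attach, (Nat.totient e.1 : ℤ) * totientQuotient y (n / (n / d * e.1))
      = ∑ e ∈ d.divisors, (Nat.totient e : ℤ) * totientQuotient y (d / e) := by
        rw [← Finset.sum_attach d.divisors]
        refine Finset.sum_congr rfl fun e _ => ?_
        rw [← Nat.div_div_eq_div_mul, Nat.div_div_self hdn hn]
    _ = y d := sum_totient_mul_totientQuotient y hd0
    _ = w ⟨d, hd⟩ := dif_pos hd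

/-- For a positive integer `n` and the additive subgroup `B` of the product
group `∏_{m ∣ n} ℤ` whose underlying set is `B_n` (the functions satisfying the
Cauchy–Frobenius–Burnside congruences), the quotient abelian group `(∏_{m ∣ n} ℤ)/B_n` is
finite of order `∏_{q ∣ n} q`; in particular every prime dividing the order of the quotient
divides `n`. -/
theorem burnside_quotient_card (n : ℕ) (hn : 0 < n)
    (B : AddSubgroup ({m : ℕ // m ∈ n.divisors} → ℤ)) (hB : (B : Set _) = BurnsideSet n) :
    Finite (({m : ℕ // m ∈ n.divisors} → ℤ) ⧸ B) ∧
    Nat.card (({m : ℕ // m ∈ n.divisors} → ℤ) ⧸ B) = ∏ q ∈ n.divisors, q ∧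
    ∀ p : ℕ, p.Prime → p ∣ Nat.card (({m : ℕ // m ∈ n.divisors} → ℤ) ⧸ B) → p ∣ n := by
  have hker : (burnsideResidue n).ker = B := by
    ext x
    rw [AddMonoidHom.mem_ker, burnsideResidue_eq_zero_iff, ← hB, SetLike.mem_coe]
  subst hker
  have hcard : Nat.card (({m : ℕ // m ∈ n.divisors} → ℤ) ⧸ (burnsideResidue n).ker) =
      ∏ q ∈ n.divisors, q := by
    rw [Nat.card_congr (QuotientAddGroup.quotientKerEquivOfSurjective _
      (burnsideResidue_surjective n)).toEquiv, Nat.card_pi]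
    simp only [Nat.card_zmod]
    exact Finset.prod_coe_sort n.divisors fun q => q
  refine ⟨Nat.finite_of_card_ne_zero ?_, hcard, fun p hp hdvd => ?_⟩
  · rw [hcard]
    exact Finset.prod_ne_zero_iff.2 fun q hq => (Nat.pos_of_mem_divisors hq).ne'
  · rw [hcard, hp.prime.dvd_finsetProd_iff] at hdvd
    obtain ⟨q, hq, hpq⟩ := hdvd
    exact hpq.trans (Nat.dvd_of_mem_divisors hq)
end

section
/- Let n be an odd positive integer. The group of units of the ring B_n consists of exactly two elements, namely the constant functions 1 and −1; hence the unit group B_nˣ is cyclic of order 2. -/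
open Finset

/-- A `±1`-valued function satisfying the congruences takes at `n / d` the value it takes at `n`,
provided that `n` is odd. -/
theorem BurnsideSet.apply_div_eq_apply_self {n : ℕ} (hodd : Odd n)
    {x : {m : ℕ // m ∈ n.divisors} → ℤ} (hx : x ∈ BurnsideSet n)
    (hx1 : ∀ m, x m = 1 ∨ x m = -1) (hn : n ∈ n.divisors) (d : ℕ) (hd : d ∣ n)
    (hnd : n / d ∈ n.divisors) : x ⟨n / d, hnd⟩ = x ⟨n, hn⟩ := by
  induction d using Nat.strong_induction_on with
  | _ d ih =>
    have hd0 : 0 < d := Nat.pos_of_dvd_of_pos hd hodd.pos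
    have hd' : d ∈ n.divisors := Nat.mem_divisors.mpr ⟨hd, hodd.pos.ne'⟩
    have hsum : ∑ e ∈ d.divisors.attach, (Nat.totient e.1 : ℤ) *
        (x ⟨n / d * e.1, divMulMem n d e.1 hd' e.2⟩ - x ⟨n, hn⟩)
        = x ⟨n / d, hnd⟩ - x ⟨n, hn⟩ := by
      rw [Finset.sum_eq_single ⟨1, Nat.one_mem_divisors.mpr hd0.ne'⟩]
      · simp
      · rintro ⟨e, he⟩ - hne
        have hed : e ∣ d := (Nat.mem_divisors.mp he).1
        have he0 : 0 < e := Nat.pos_of_dvd_of_pos hed hd0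
        have he1 : 1 < e := by
          exact lt_of_le_of_ne he0 fun h => hne (Subtype.ext h.symm)
        have hmul : n / d * e = n / (d / e) := by
          obtain ⟨k, rfl⟩ := hed
          obtain ⟨l, rfl⟩ := hd
          have hk : 0 < k := Nat.pos_of_mul_pos_left hd0
          rw [Nat.mul_div_cancel_left _ hd0, Nat.mul_div_cancel_left _ he0,
            show e * k * l = k * (l * e) by ring, Nat.mul_div_cancel_left _ hk]
        have key := ih (d / e) (Nat.div_lt_self hd0 he1) ((Nat.div_dvd_of_dvd hed).trans hd)
          (hmul ▸ divMulMem n d e hd' he)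
        simp only [hmul, key, sub_self, mul_zero]
      · simp
    have htot : ∑ e ∈ d.divisors.attach, (Nat.totient e.1 : ℤ) = d := by
      rw [Finset.sum_attach d.divisors fun e => (Nat.totient e : ℤ)]
      exact_mod_cast Nat.sum_totient d
    have hdvd : (d : ℤ) ∣ x ⟨n / d, hnd⟩ - x ⟨n, hn⟩ := by
      rw [← hsum]
      simp only [mul_sub, Finset.sum_sub_distrib, ← Finset.sum_mul, htot]
      exact dvd_sub (hx d hd') (dvd_mul_right _ _)
    have hdodd : Odd d := hodd.of_dvd_nat hd
    by_contra hne
    have h2 : (d : ℤ) ∣ 2 := by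
      rcases hx1 ⟨n / d, hnd⟩ with h | h <;> rcases hx1 ⟨n, hn⟩ with h' | h' <;>
        rw [h, h'] at hdvd hne
      · exact absurd rfl hne
      · simpa using hdvd
      · simpa using (dvd_neg.mpr hdvd)
      · exact absurd rfl hne
    have hd1 : d = 1 := by
      rcases (Nat.dvd_prime Nat.prime_two).mp (by exact_mod_cast h2) with h | h
      · exact h
      · subst h; exact absurd hdodd (by decide)
    subst hd1
    exact hne (by simp)

/-- Let `n` be an odd positive integer, and let `B` be the subring of the
product ring `∏_{m ∣ n} ℤ` whose underlying set is `B_n` (the functions satisfying the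
Cauchy–Frobenius–Burnside congruences). Then the group of units of `B` consists of exactly
the two elements `1` and `-1` (the constant functions); hence `Bˣ` is cyclic of order `2`. -/
theorem burnside_units_odd (n : ℕ) (hn : 0 < n) (hodd : Odd n)
    (B : Subring ({m : ℕ // m ∈ n.divisors} → ℤ)) (hB : (B : Set _) = BurnsideSet n) :
    (∀ u : Bˣ, u = 1 ∨ u = -1) ∧ (1 : Bˣ) ≠ -1 ∧ IsCyclic Bˣ ∧ Nat.card Bˣ = 2 := by
  have hnn : n ∈ n.divisors := Nat.mem_divisors_self n hn.ne'
  have hne : (1 : Bˣ) ≠ -1 := fun h => by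
    have := congrFun (congrArg (fun u : Bˣ => ((u : B) : {m : ℕ // m ∈ n.divisors} → ℤ)) h)
      ⟨n, hnn⟩
    norm_num at this
  have hunits : ∀ u : Bˣ, u = 1 ∨ u = -1 := by
    intro u
    have hu : ((u : B) : {m : ℕ // m ∈ n.divisors} → ℤ) ∈ BurnsideSet n := hB ▸ (u : B).2
    have hu1 : ∀ m, (u : B).1 m = 1 ∨ (u : B).1 m = -1 := fun m =>
      Int.isUnit_iff.mp
        ((u.isUnit.map B.subtype).map (Pi.evalRingHom (fun _ => ℤ) m))
    have hconst : ∀ m, (u : B).1 m = (u : B).1 ⟨n, hnn⟩ := by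
      rintro ⟨m, hm⟩
      have hmn := (Nat.mem_divisors.mp hm).1
      have hdiv : n / (n / m) = m := Nat.div_div_self hmn hn.ne'
      have key := BurnsideSet.apply_div_eq_apply_self hodd hu hu1 hnn (n / m)
        (Nat.div_dvd_of_dvd hmn) (hdiv.symm ▸ hm)
      simpa only [hdiv] using key
    refine (hu1 ⟨n, hnn⟩).imp (fun h => ?_) (fun h => ?_) <;>
    · ext m
      simpa [h] using hconst m
  have hcard : Nat.card Bˣ = 2 :=
    Nat.card_eq_two_iff.mpr ⟨1, -1, hne, Set.eq_univ_of_forall hunits⟩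
  have : Fact (Nat.Prime 2) := ⟨Nat.prime_two⟩
  exact ⟨hunits, hne, isCyclic_of_prime_card hcard, hcard⟩
end

section
/- Let n be an even positive integer. The group of units of the ring B_n is exactly {1, −1, τ, −τ}, where 1 and −1 denote the constant functions and τ is the function on divisors of n given by τ(m) = 1 if m divides n/2 and τ(m) = −1 otherwise; hence B_nˣ is isomorphic to ℤ/2 × ℤ/2, generated by the constant function −1 and by τ. -/
open Finset

/-- The function `τ` on the divisors of `n`, taking the value `1` on divisors of `n/2` and
`-1` otherwise; it corresponds to the virtual `C_n`-set `[C_n/C_{n/2}] - [C_n/C_n]`. -/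
def tauFun (n : ℕ) : {m : ℕ // m ∈ n.divisors} → ℤ :=
  fun m => if (m : ℕ) ∣ n / 2 then 1 else -1

theorem tauFun_mem_burnsideSet {n : ℕ} (hn : 0 < n) (heven : Even n) :
    tauFun n ∈ BurnsideSet n := by
  intro d hd
  obtain ⟨c, rfl⟩ := (Nat.mem_divisors.mp hd).1
  have hd0 : 0 < d := Nat.pos_of_mul_pos_right hn
  have hc0 : 0 < c := Nat.pos_of_mul_pos_left hn
  have hdc : d * c / d = c := Nat.mul_div_cancel_left c hd0
  have key (e : ℕ) : d * c / d * e ∣ d * c / 2 ↔ 2 * e ∣ d := by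
    rw [hdc, Nat.dvd_div_iff_mul_dvd heven.two_dvd, ← mul_assoc, mul_comm 2 c, mul_assoc,
      mul_comm d c, Nat.mul_dvd_mul_iff_left hc0]
  have hsum : ∑ e ∈ d.divisors.attach, (Nat.totient e.1 : ℤ) *
      tauFun (d * c) ⟨d * c / d * e.1, divMulMem (d * c) d e.1 hd e.2⟩ =
      ∑ e ∈ d.divisors, (Nat.totient e : ℤ) * (if 2 * e ∣ d then 1 else -1) := by
    rw [← sum_attach d.divisors]
    exact sum_congr rfl fun e _ => by simp only [tauFun, key]
  rw [hsum]
  have htot (k : ℕ) : ∑ e ∈ k.divisors, (Nat.totient e : ℤ) = k := by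
    exact_mod_cast Nat.sum_totient k
  have hsplit : ∑ e ∈ d.divisors, (Nat.totient e : ℤ) * (if 2 * e ∣ d then 1 else -1) =
      2 * ∑ e ∈ d.divisors with 2 * e ∣ d, (Nat.totient e : ℤ) - d := by
    rw [← htot d, sum_filter, mul_sum, ← sum_sub_distrib]
    exact sum_congr rfl fun e _ => by split_ifs <;> ring
  rw [hsplit]
  refine dvd_sub ?_ dvd_rfl
  by_cases h2 : 2 ∣ d
  · obtain ⟨k, rfl⟩ := h2
    have hfilter : {e ∈ (2 * k).divisors | 2 * e ∣ 2 * k} = k.divisors := by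
      ext e
      rw [mem_filter, Nat.mem_divisors, Nat.mem_divisors, Nat.mul_dvd_mul_iff_left two_pos]
      exact ⟨fun h => ⟨h.2, by lia⟩, fun h => ⟨⟨h.1.mul_left 2, by lia⟩, h.1⟩⟩
    rw [hfilter, htot]
    push_cast
    rfl
  · rw [filter_false_of_mem fun e _ he => h2 (dvd_of_mul_right_dvd he)]
    simp

theorem eq_one_of_mem_burnsideSet {n : ℕ}
    {x : {m : ℕ // m ∈ n.divisors} → ℤ} (hx : x ∈ BurnsideSet n)
    (hunit : ∀ m, x m = 1 ∨ x m = -1)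
    (htop : ∀ h, x ⟨n, h⟩ = 1) (hhalf : ∀ h, x ⟨n / 2, h⟩ = 1) : x = 1 := by
  have key (d : ℕ) : d ∣ n → ∀ h, x ⟨n / d, h⟩ = 1 := by
    induction d using Nat.strong_induction_on with
    | _ d ih =>
    intro hdn h
    have hn : n ≠ 0 := (Nat.mem_divisors.mp h).2
    have hd0 : 0 < d := Nat.pos_of_dvd_of_pos hdn (Nat.pos_of_ne_zero hn)
    by_cases h1 : d = 1
    · subst h1
      simpa using htop (by simpa using h)
    by_cases h2 : d = 2
    · subst h2
      exact hhalf h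
    have hd : d ∈ n.divisors := Nat.mem_divisors.mpr ⟨hdn, hn⟩
    have hterm : ∀ e ∈ d.divisors.attach,
        (Nat.totient e.1 : ℤ) * x ⟨n / d * e.1, divMulMem n d e.1 hd e.2⟩ =
        (Nat.totient e.1 : ℤ) + if e.1 = 1 then x ⟨n / d, h⟩ - 1 else 0 := by
      rintro ⟨e, he⟩ -
      by_cases he1 : e = 1
      · subst he1
        simp
      · obtain ⟨k, rfl⟩ := (Nat.mem_divisors.mp he).1
        have he0 : 0 < e := Nat.pos_of_mul_pos_right hd0
        have hk0 : 0 < k := Nat.pos_of_mul_pos_left hd0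
        have hkn : k ∣ n := dvd_of_mul_left_dvd hdn
        have hdiv : n / (e * k) * e = n / k := by
          obtain ⟨c, rfl⟩ := hdn
          rw [Nat.mul_div_cancel_left _ hd0, mul_comm e k, mul_assoc,
            Nat.mul_div_cancel_left _ hk0, mul_comm]
        have hlt : k < e * k := lt_mul_of_one_lt_left hk0 (by lia)
        have hval := ih k hlt hkn (hdiv ▸ divMulMem n (e * k) e hd he)
        simp only [hdiv, hval, he1, if_false, mul_one, add_zero]
    have hdvd := hx d hd
    have htot : ∑ e ∈ d.divisors, (Nat.totient e : ℤ) = d := by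
      exact_mod_cast Nat.sum_totient d
    rw [sum_congr rfl hterm,
      sum_attach d.divisors fun e => (Nat.totient e : ℤ) + if e = 1 then x ⟨n / d, h⟩ - 1 else 0,
      sum_add_distrib, htot, sum_ite_eq' d.divisors,
      if_pos (Nat.one_mem_divisors.mpr hd0.ne')] at hdvd
    rcases hunit ⟨n / d, h⟩ with hv | hv
    · exact hv
    · rw [hv] at hdvd
      have hdvd2 : (d : ℤ) ∣ 2 := by simpa using (dvd_add_right (dvd_refl (d : ℤ))).mp hdvd
      have := Nat.le_of_dvd two_pos (by exact_mod_cast hdvd2 : d ∣ 2)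
      lia
  funext ⟨m, hm⟩
  obtain ⟨hmn, hn⟩ := Nat.mem_divisors.mp hm
  have hdiv : n / (n / m) = m := Nat.div_div_self hmn hn
  have hval := key (n / m) (Nat.div_dvd_of_dvd hmn) (by rwa [hdiv])
  simp only [hdiv] at hval
  exact hval

theorem isKleinFour_of_forall_eq {G : Type*} [Group G] [HasDistribNeg G] {u : G}
    (hu : u * u = 1) (hneg : (1 : G) ≠ -1) (hu1 : u ≠ 1) (hu2 : u ≠ -1)
    (h : ∀ v : G, v = 1 ∨ v = -1 ∨ v = u ∨ v = -u) : IsKleinFour G where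
  card_four := by
    classical
    have hne : u ≠ -u := fun e => hneg <| by
      simpa [hu] using congrArg (u * ·) e
    have huniv : ({1, -1, u, -u} : Set G) = Set.univ :=
      Set.eq_univ_of_forall fun v => by simpa using h v
    have hcard : ({1, -1, u, -u} : Finset G).card = 4 := by
      have h3 : (1 : G) ≠ -u := fun e => hu2 <| by rw [e, neg_neg]
      rw [card_insert_of_notMem, card_insert_of_notMem, card_insert_of_notMem, card_singleton]
      · simpa using hne
      · simpa using ⟨hu2.symm, fun e => hu1 e.symm⟩
      · simpa using ⟨hneg, hu1.symm, h3⟩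
    rw [← Set.ncard_univ, ← huniv, ← hcard, ← Set.ncard_coe_finset]
    simp
  exponent_two := by
    refine (Nat.dvd_prime Nat.prime_two).mp
      (Monoid.exponent_dvd_of_forall_pow_eq_one fun v => ?_) |>.resolve_left fun h1 => ?_
    · rcases h v with rfl | rfl | rfl | rfl <;> simp [pow_two, hu]
    · exact hu1 (by simpa [h1] using Monoid.pow_exponent_eq_one u)

/-- Let `n` be an even positive integer, and let `B` be the subring of the
product ring `∏_{m ∣ n} ℤ` whose underlying set is `B_n`. Then `τ ∈ B`, and the group of
units of `B` is exactly `{1, -1, τ, -τ}`; hence `Bˣ ≅ ℤ/2 × ℤ/2`, generated by the constant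
function `-1` and by `τ`. -/
theorem burnside_units_even (n : ℕ) (hn : 0 < n) (heven : Even n)
    (B : Subring ({m : ℕ // m ∈ n.divisors} → ℤ)) (hB : (B : Set _) = BurnsideSet n) :
    ∃ hτ : tauFun n ∈ B, ∃ u : Bˣ, (u : B) = ⟨tauFun n, hτ⟩ ∧
      (∀ v : Bˣ, v = 1 ∨ v = -1 ∨ v = u ∨ v = -u) ∧
      Subgroup.closure {(-1 : Bˣ), u} = ⊤ ∧
      Nonempty (Bˣ ≃* Multiplicative (ZMod 2 × ZMod 2)) := by
  have hmem {x : {m : ℕ // m ∈ n.divisors} → ℤ} : x ∈ B ↔ x ∈ BurnsideSet n := by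
    rw [← hB, SetLike.mem_coe]
  have hτ : tauFun n ∈ B := hmem.mpr (tauFun_mem_burnsideSet hn heven)
  have hsq : (⟨tauFun n, hτ⟩ : B) * ⟨tauFun n, hτ⟩ = 1 := by
    ext m
    change tauFun n m * tauFun n m = 1
    unfold tauFun
    split_ifs <;> rfl
  let u : Bˣ := ⟨⟨tauFun n, hτ⟩, ⟨tauFun n, hτ⟩, hsq, hsq⟩
  have huu : u * u = 1 := Units.ext hsq
  have hn_mem : n ∈ n.divisors := Nat.mem_divisors_self n hn.ne'
  have hhalf_mem : n / 2 ∈ n.divisors :=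
    Nat.mem_divisors.mpr ⟨Nat.div_dvd_of_dvd heven.two_dvd, hn.ne'⟩
  have hhalf_pos : 0 < n / 2 := Nat.div_pos (Nat.le_of_dvd hn heven.two_dvd) two_pos
  let ev (m : {m : ℕ // m ∈ n.divisors}) (v : Bˣ) : ℤ := (v : B).1 m
  have hev_u_top : ev ⟨n, hn_mem⟩ u = -1 :=
    if_neg (Nat.not_dvd_of_pos_of_lt hhalf_pos (Nat.div_lt_self hn one_lt_two))
  have hev_u_half : ev ⟨n / 2, hhalf_mem⟩ u = 1 := if_pos dvd_rfl
  have hev_one (m) : ev m 1 = 1 := rfl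
  have hev_neg (m) (v : Bˣ) : ev m (-v) = -ev m v := rfl
  have hev_mul (m) (v w : Bˣ) : ev m (v * w) = ev m v * ev m w := rfl
  have hev_unit (m) (v : Bˣ) : ev m v = 1 ∨ ev m v = -1 :=
    Int.isUnit_iff.mp <| IsUnit.of_mul_eq_one (ev m v⁻¹) <| by
      rw [← hev_mul, mul_inv_cancel, hev_one]
  have heq_one (v : Bˣ) (htop : ev ⟨n, hn_mem⟩ v = 1) (hhalf : ev ⟨n / 2, hhalf_mem⟩ v = 1) :
      v = 1 :=
    Units.ext <| Subtype.ext <| eq_one_of_mem_burnsideSet (hmem.mp (v : B).2)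
      (fun m => hev_unit m v) (fun _ => htop) (fun _ => hhalf)
  have hcases (v : Bˣ) : v = 1 ∨ v = -1 ∨ v = u ∨ v = -u := by
    have hmul_u (w : Bˣ) (hw : w * u = 1) : w = u := by
      rw [eq_inv_of_mul_eq_one_left hw, inv_eq_of_mul_eq_one_left huu]
    rcases hev_unit ⟨n, hn_mem⟩ v with h1 | h1 <;>
      rcases hev_unit ⟨n / 2, hhalf_mem⟩ v with h2 | h2
    · exact .inl (heq_one v h1 h2)
    · refine .inr (.inr (.inr (neg_eq_iff_eq_neg.mp (hmul_u _ (heq_one _ ?_ ?_)))))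
      · rw [hev_mul, hev_neg, h1, hev_u_top]; rfl
      · rw [hev_mul, hev_neg, h2, hev_u_half]; rfl
    · refine .inr (.inr (.inl (hmul_u _ (heq_one _ ?_ ?_))))
      · rw [hev_mul, h1, hev_u_top]; rfl
      · rw [hev_mul, h2, hev_u_half]; rfl
    · refine .inr (.inl (neg_eq_iff_eq_neg.mp (heq_one _ ?_ ?_)))
      · rw [hev_neg, h1, neg_neg]
      · rw [hev_neg, h2, neg_neg]
  have hneg : (1 : Bˣ) ≠ -1 := fun h => by
    have := congrArg (ev ⟨n, hn_mem⟩) h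
    rw [hev_neg, hev_one] at this
    lia
  have hu1 : u ≠ 1 := fun h => by
    have := congrArg (ev ⟨n, hn_mem⟩) h
    rw [hev_u_top, hev_one] at this
    lia
  have hu2 : u ≠ -1 := fun h => by
    have := congrArg (ev ⟨n / 2, hhalf_mem⟩) h
    rw [hev_u_half, hev_neg, hev_one] at this
    lia
  refine ⟨hτ, u, rfl, hcases, ?_, ?_⟩
  · refine (Subgroup.eq_top_iff' _).mpr fun v => ?_
    have h1 : (-1 : Bˣ) ∈ Subgroup.closure {(-1 : Bˣ), u} := Subgroup.subset_closure (by simp)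
    have h2 : u ∈ Subgroup.closure {(-1 : Bˣ), u} := Subgroup.subset_closure (by simp)
    rcases hcases v with rfl | rfl | rfl | rfl
    · exact one_mem _
    · exact h1
    · exact h2
    · simpa using mul_mem h1 h2
  · have := isKleinFour_of_forall_eq huu hneg hu1 hu2 hcases
    exact IsKleinFour.nonempty_mulEquiv
end

section
/- Let n be a positive integer. The Picard group of the commutative ring B_n is isomorphic to the product, over all divisors d of n with d ≠ 1 and d ≠ 2, of the quotient groups (ℤ/d)ˣ/{±1}, where {±1} denotes the subgroup of (ℤ/d)ˣ generated by −1. That is, Pic(B_n) ≅ ∏_{d ∣ n, d ≠ 1,2} (ℤ/d)ˣ/{±1}. -/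
open Finset

open CategoryTheory

/-- The Picard group of a commutative ring `R`: the abelian group of isomorphism classes of
invertible `R`-modules (modules `M` admitting an `N` with `M ⊗[R] N ≅ R`), with the group
structure induced by the tensor product. It is realized here as the group of units of the
monoid of isomorphism classes of `R`-modules under `⊗`. -/
noncomputable def RingPic (R : Type) [CommRing R] : Type 1 :=
  (Skeleton (ModuleCat.{0} R))ˣ

noncomputable instance (R : Type) [CommRing R] : CommGroup (RingPic R) :=
  inferInstanceAs (CommGroup (Skeleton (ModuleCat.{0} R))ˣ)

section Congruences

variable {M : Type*} [AddCommGroup M]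

/-- The Dirichlet convolution of integer coefficients `c` with a sequence `y` in an abelian
group. -/
def divisorSum (c : ℕ → ℤ) (y : ℕ → M) (d : ℕ) : M :=
  ∑ e ∈ d.divisors, c e • y (d / e)

theorem divisorSum_eq_add {c : ℕ → ℤ} {r : ℤ} {p : ℕ} (hp : p.Prime)
    (hdvd : ∀ e, p ∣ e → c (p * e) = r * c e)
    (hndvd : ∀ e, ¬ p ∣ e → c (p * e) = r * c e - c e)
    (y : ℕ → M) {d : ℕ} (hd : d ≠ 0) (hpd : p ∣ d) :
    divisorSum c y d = r • divisorSum c y (d / p) +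
      ∑ e ∈ d.divisors with ¬ p ∣ e, c e • (y (d / e) - y (d / e / p)) := by
  obtain ⟨m, rfl⟩ := hpd
  have hm : m ≠ 0 := right_ne_zero_of_mul hd
  rw [Nat.mul_div_cancel_left _ hp.pos]
  have himage : {e ∈ (p * m).divisors | p ∣ e} = m.divisors.image (p * ·) := by
    ext e
    simp only [mem_filter, Nat.mem_divisors, mem_image]
    constructor
    · rintro ⟨⟨h, -⟩, f, rfl⟩
      exact ⟨f, ⟨Nat.dvd_of_mul_dvd_mul_left hp.pos h, hm⟩, rfl⟩
    · rintro ⟨f, ⟨h, -⟩, rfl⟩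
      exact ⟨⟨mul_dvd_mul_left _ h, hd⟩, dvd_mul_right _ _⟩
  have hcoprime : {e ∈ (p * m).divisors | ¬ p ∣ e} = {e ∈ m.divisors | ¬ p ∣ e} := by
    ext e
    simp only [mem_filter, Nat.mem_divisors]
    constructor
    · rintro ⟨⟨h, -⟩, he⟩
      exact ⟨⟨((Nat.Prime.coprime_iff_not_dvd hp).2 he).symm.dvd_of_dvd_mul_left h, hm⟩, he⟩
    · rintro ⟨⟨h, -⟩, he⟩
      exact ⟨⟨h.mul_left _, hd⟩, he⟩
  have hmul : ∑ e ∈ (p * m).divisors with p ∣ e, c e • y (p * m / e) =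
      r • divisorSum c y m - ∑ e ∈ m.divisors with ¬ p ∣ e, c e • y (m / e) := by
    rw [himage, sum_image fun a _ b _ h => Nat.eq_of_mul_eq_mul_left hp.pos h, sum_filter,
      divisorSum, smul_sum, ← sum_sub_distrib]
    refine sum_congr rfl fun e _ => ?_
    rw [Nat.mul_div_mul_left _ _ hp.pos]
    split_ifs with h
    · rw [hdvd e h, mul_smul, sub_zero]
    · rw [hndvd e h, sub_smul, mul_smul]
  rw [divisorSum, ← sum_filter_add_sum_filter_not _ (p ∣ ·), hmul]
  simp only [smul_sub, sum_sub_distrib]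
  have hdiv : ∑ e ∈ (p * m).divisors with ¬ p ∣ e, c e • y (p * m / e / p) =
      ∑ e ∈ m.divisors with ¬ p ∣ e, c e • y (m / e) := by
    rw [hcoprime]
    refine sum_congr rfl fun e _ => ?_
    rw [Nat.div_div_eq_div_mul, mul_comm e p, Nat.mul_div_mul_left _ _ hp.pos]
  rw [hdiv]
  abel

/-- The convolution of `y` with `c` is divisible in the sense of a filtration `K` if and only if
`y` satisfies the Dold congruences relative to `K`. -/
theorem divisorSum_mem_iff {c : ℕ → ℤ} {r : ℤ} {p : ℕ} (hp : p.Prime) (hone : c 1 = 1)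
    (hdvd : ∀ e, p ∣ e → c (p * e) = r * c e)
    (hndvd : ∀ e, ¬ p ∣ e → c (p * e) = r * c e - c e)
    (K : ℕ → AddSubgroup M) (hzero : K 0 = ⊤) (hK : ∀ k, ∀ x ∈ K k, r • x ∈ K (k + 1))
    (y : ℕ → M) {n : ℕ} (hn : n ≠ 0) :
    (∀ d, d ∣ n → ∀ k, p ^ k ∣ d → divisorSum c y d ∈ K k) ↔
      ∀ d, d ∣ n → ∀ k, p ^ (k + 1) ∣ d → y d - y (d / p) ∈ K (k + 1) := by
  have hquot {d e k : ℕ} (hed : e ∣ d) (he : ¬ p ∣ e) (hk : p ^ (k + 1) ∣ d) :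
      p ^ (k + 1) ∣ d / e := by
    obtain ⟨f, rfl⟩ := hed
    rcases Nat.eq_zero_or_pos e with rfl | hpos
    · simp
    rw [Nat.mul_div_cancel_left _ hpos]
    exact (((Nat.Prime.coprime_iff_not_dvd hp).2 he).pow_left _).dvd_of_dvd_mul_left hk
  have hpow {d k : ℕ} (hk : p ^ (k + 1) ∣ d) : p ^ k ∣ d / p :=
    Nat.dvd_div_of_mul_dvd (by rwa [← pow_succ'])
  have hdvd' {d k : ℕ} (hk : p ^ (k + 1) ∣ d) : p ∣ d :=
    (dvd_pow_self p k.succ_ne_zero).trans hk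
  constructor
  · intro h d
    induction d using Nat.strong_induction_on with
    | _ d ih =>
      intro hd k hk
      have hd0 : d ≠ 0 := ne_zero_of_dvd_ne_zero hn hd
      have hS := divisorSum_eq_add hp hdvd hndvd y hd0 (hdvd' hk)
      have hmem : 1 ∈ {e ∈ d.divisors | ¬ p ∣ e} := by
        simp [hd0, hp.one_lt.ne']
      rw [← add_sum_erase _ _ hmem, hone, one_smul, Nat.div_one] at hS
      have hdiff : y d - y (d / p) = divisorSum c y d - r • divisorSum c y (d / p) -
          ∑ e ∈ {e ∈ d.divisors | ¬ p ∣ e}.erase 1, c e • (y (d / e) - y (d / e / p)) := by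
        rw [hS]; abel
      rw [hdiff]
      refine sub_mem (sub_mem (h d hd _ hk) (hK _ _ (h _ ((Nat.div_dvd_of_dvd (hdvd' hk)).trans hd)
        _ (hpow hk)))) (sum_mem fun e he => zsmul_mem ?_ _)
      simp only [mem_erase, mem_filter, Nat.mem_divisors] at he
      refine ih _ (Nat.div_lt_self (Nat.pos_of_ne_zero hd0) ?_)
        ((Nat.div_dvd_of_dvd he.2.1.1).trans hd) _ (hquot he.2.1.1 he.2.2 hk)
      have := Nat.pos_of_dvd_of_pos he.2.1.1 (Nat.pos_of_ne_zero hd0)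
      omega
  · intro h d
    induction d using Nat.strong_induction_on with
    | _ d ih =>
      rintro hd (_ | k) hk
      · simp [hzero]
      have hd0 : d ≠ 0 := ne_zero_of_dvd_ne_zero hn hd
      rw [divisorSum_eq_add hp hdvd hndvd y hd0 (hdvd' hk)]
      refine add_mem (hK _ _ (ih _ (Nat.div_lt_self (Nat.pos_of_ne_zero hd0) hp.one_lt)
        ((Nat.div_dvd_of_dvd (hdvd' hk)).trans hd) _ (hpow hk))) (sum_mem fun e he =>
          zsmul_mem ?_ _)
      simp only [mem_filter, Nat.mem_divisors] at he
      exact h _ ((Nat.div_dvd_of_dvd he.1.1).trans hd) _ (hquot he.1.1 he.2 hk)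

end Congruences

theorem Int.natCast_dvd_iff_prime_pow {d : ℕ} {a : ℤ} :
    (d : ℤ) ∣ a ↔ ∀ p : ℕ, p.Prime → ∀ k, p ^ k ∣ d → ((p ^ k : ℕ) : ℤ) ∣ a := by
  simp only [Int.natCast_dvd]
  rw [Nat.dvd_iff_prime_pow_dvd_dvd]
  exact forall_congr' fun p => ⟨fun h hp k => h k hp, fun h k hp => h hp k⟩

/-- The Dold congruences for an integer sequence on the divisors of `n`. -/
def DoldCongruences (n : ℕ) (y : ℕ → ℤ) : Prop :=
  ∀ p : ℕ, p.Prime → ∀ d, d ∣ n → ∀ k, p ^ (k + 1) ∣ d →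
    ((p ^ (k + 1) : ℕ) : ℤ) ∣ y d - y (d / p)

theorem forall_dvd_divisorSum_totient_iff {n : ℕ} (hn : n ≠ 0) (y : ℕ → ℤ) :
    (∀ d, d ∣ n → (d : ℤ) ∣ divisorSum (fun e => (Nat.totient e : ℤ)) y d) ↔
      DoldCongruences n y := by
  have key (p : ℕ) (hp : p.Prime) := divisorSum_mem_iff (c := fun e => (Nat.totient e : ℤ))
    (r := p) hp (by simp) (fun e he => by simp [Nat.totient_mul_of_prime_of_dvd hp he])
    (fun e he => by
      simp only [Nat.totient_mul_of_prime_of_not_dvd hp he, Nat.cast_mul, Nat.cast_pred hp.pos]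
      ring)
    (fun k => AddSubgroup.zmultiples ((p ^ k : ℕ) : ℤ)) (by
      rw [pow_zero, Nat.cast_one, AddSubgroup.eq_top_iff']
      exact fun x => Int.mem_zmultiples_iff.2 (one_dvd x))
    (fun k x hx => by
      rw [Int.mem_zmultiples_iff] at hx ⊢
      rw [pow_succ', Nat.cast_mul, smul_eq_mul]
      exact mul_dvd_mul_left _ hx) y hn
  simp only [Int.mem_zmultiples_iff] at key
  rw [DoldCongruences, forall₂_congr fun p hp => (key p hp).symm]
  exact ⟨fun h p hp d hd => Int.natCast_dvd_iff_prime_pow.1 (h d hd) p hp,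
    fun h d hd => Int.natCast_dvd_iff_prime_pow.2 fun p hp => h p hp d hd⟩

theorem Nat.div_div_eq_div_mul_of_dvd {n d e : ℕ} (hn : n ≠ 0) (hd : d ∣ n) (he : e ∣ d) :
    n / (d / e) = n / d * e := by
  obtain ⟨f, rfl⟩ := he
  obtain ⟨a, rfl⟩ := hd
  have hd0 := left_ne_zero_of_mul hn
  have he0 := Nat.pos_of_ne_zero (left_ne_zero_of_mul hd0)
  have hf0 := Nat.pos_of_ne_zero (right_ne_zero_of_mul hd0)
  rw [Nat.mul_div_cancel_left _ he0, Nat.mul_div_cancel_left _ (Nat.mul_pos he0 hf0),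
    show e * f * a = f * (a * e) by ring, Nat.mul_div_cancel_left _ hf0]

/-- A function on the divisors of `n`, reindexed by complementary divisors and extended to all
natural numbers by a default value. -/
def complementaryExtension {α : Type*} [Inhabited α] {n : ℕ} (x : {m : ℕ // m ∈ n.divisors} → α)
    (d : ℕ) : α :=
  if h : n / d ∈ n.divisors then x ⟨n / d, h⟩ else default

theorem complementaryExtension_div {α : Type*} [Inhabited α] {n : ℕ}
    (x : {m : ℕ // m ∈ n.divisors} → α) (m : {m : ℕ // m ∈ n.divisors}) :
    complementaryExtension x (n / m) = x m := by
  have h : n / (n / m) = m :=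
    Nat.div_div_self (Nat.dvd_of_mem_divisors m.2) (Nat.mem_divisors.1 m.2).2
  rw [complementaryExtension, dif_pos (h.symm ▸ m.2)]
  simp only [h]

theorem exists_eq_div_of_dvd {n d : ℕ} (hn : n ≠ 0) (hd : d ∣ n) :
    ∃ m : {m : ℕ // m ∈ n.divisors}, d = n / m :=
  ⟨⟨n / d, Nat.mem_divisors.2 ⟨Nat.div_dvd_of_dvd hd, hn⟩⟩, (Nat.div_div_self hd hn).symm⟩

theorem mem_burnsideSet_iff_s5 {n : ℕ} (hn : n ≠ 0) (x : {m : ℕ // m ∈ n.divisors} → ℤ) :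
    x ∈ BurnsideSet n ↔ DoldCongruences n (complementaryExtension x) := by
  rw [← forall_dvd_divisorSum_totient_iff hn]
  simp only [BurnsideSet, Set.mem_ofPred_eq, Nat.mem_divisors]
  have heq (d : ℕ) (hd : d ∣ n) : ∑ e ∈ d.divisors.attach, (Nat.totient e.1 : ℤ) *
      x ⟨n / d * e.1, divMulMem n d e.1 (Nat.mem_divisors.2 ⟨hd, hn⟩) e.2⟩ =
      divisorSum (fun e => (Nat.totient e : ℤ)) (complementaryExtension x) d := by
    rw [divisorSum, ← sum_attach d.divisors]
    refine sum_congr rfl fun e _ => ?_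
    have he := (Nat.mem_divisors.1 e.2).1
    have hdiv := Nat.div_div_eq_div_mul_of_dvd hn hd he
    have hmem : n / (d / e.1) ∈ n.divisors :=
      hdiv ▸ divMulMem n d e.1 (Nat.mem_divisors.2 ⟨hd, hn⟩) e.2
    rw [complementaryExtension, dif_pos hmem, smul_eq_mul]
    simp only [hdiv]
  exact ⟨fun h d hd => heq d hd ▸ h d ⟨hd, hn⟩, fun h d hd => (heq d hd.1).symm ▸ h d hd.1⟩

section UnitCongruences

open ArithmeticFunction

/-- The Möbius transform of sequences in a commutative group. -/
def moebiusProd (G : Type*) [CommGroup G] (d : ℕ) : (ℕ → G) →* G where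
  toFun u := ∏ e ∈ d.divisors, u (d / e) ^ moebius e
  map_one' := by simp
  map_mul' u v := by simp [mul_zpow, prod_mul_distrib]

theorem moebiusProd_apply {G : Type*} [CommGroup G] (d : ℕ) (u : ℕ → G) :
    moebiusProd G d u = ∏ e ∈ d.divisors, u (d / e) ^ moebius e := rfl

theorem moebiusProd_prod_divisors {G : Type*} [CommGroup G] (s : ℕ → G) {d : ℕ} (hd : 0 < d) :
    moebiusProd G d (fun k => ∏ i ∈ k.divisors, s i) = s d := by
  have h := (prod_eq_iff_prod_pow_moebius_eq (f := s)
    (g := fun k => ∏ i ∈ k.divisors, s i)).1 (fun _ _ => rfl) d hd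
  rw [← h, moebiusProd_apply, Nat.prod_divisorsAntidiagonal
    (f := fun i j => (∏ k ∈ j.divisors, s k) ^ moebius i)]

theorem moebius_prime_mul_of_dvd {p e : ℕ} (hp : p.Prime) (he : p ∣ e) :
    moebius (p * e) = 0 := by
  refine moebius_eq_zero_of_not_squarefree fun h => hp.not_isUnit (h p ?_)
  exact mul_dvd_mul_left p he

theorem moebius_prime_mul_of_not_dvd {p e : ℕ} (hp : p.Prime) (he : ¬ p ∣ e) :
    moebius (p * e) = -moebius e := by
  rw [isMultiplicative_moebius.map_mul_of_coprime ((Nat.Prime.coprime_iff_not_dvd hp).2 he),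
    moebius_apply_prime hp, neg_one_mul]

theorem ZMod.unitsMap_eq_unitsMap_iff {m n : ℕ} (h : m ∣ n) {u v : (ZMod n)ˣ} {a b : ℤ}
    (ha : (a : ZMod n) = u) (hb : (b : ZMod n) = v) :
    ZMod.unitsMap h u = ZMod.unitsMap h v ↔ (m : ℤ) ∣ a - b := by
  rw [Units.ext_iff, ZMod.unitsMap_val, ZMod.unitsMap_val, ← ha, ← hb, ZMod.cast_intCast h,
    ZMod.cast_intCast h, eq_comm, ZMod.intCast_eq_intCast_iff_dvd_sub]

theorem ZMod.exists_intCast_eq {n : ℕ} (a : ZMod n) : ∃ b : ℤ, (b : ZMod n) = a :=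
  ZMod.intCast_surjective a

/-- The units of `ZMod n` that are congruent to `1` modulo `gcd(m, n)`. -/
def congruenceUnits (n m : ℕ) : Subgroup (ZMod n)ˣ :=
  (ZMod.unitsMap (Nat.gcd_dvd_right m n)).ker

theorem mem_congruenceUnits_iff {n m : ℕ} (h : m ∣ n) {u : (ZMod n)ˣ} {a : ℤ}
    (ha : (a : ZMod n) = u) : u ∈ congruenceUnits n m ↔ (m : ℤ) ∣ a - 1 := by
  rw [congruenceUnits, MonoidHom.mem_ker, ← map_one (ZMod.unitsMap (Nat.gcd_dvd_right m n)),
    ZMod.unitsMap_eq_unitsMap_iff _ ha (b := 1) (by simp), Nat.gcd_eq_left h]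

theorem div_mem_congruenceUnits_iff {n m : ℕ} (h : m ∣ n) {u v : (ZMod n)ˣ} {a b : ℤ}
    (ha : (a : ZMod n) = u) (hb : (b : ZMod n) = v) :
    u / v ∈ congruenceUnits n m ↔ (m : ℤ) ∣ a - b := by
  rw [congruenceUnits, MonoidHom.mem_ker, map_div, div_eq_one,
    ZMod.unitsMap_eq_unitsMap_iff _ ha hb, Nat.gcd_eq_left h]

theorem forall_unitsMap_moebiusProd_eq_one_iff {n : ℕ} (hn : n ≠ 0) (u : ℕ → (ZMod n)ˣ)
    (y : ℕ → ℤ) (hy : ∀ d, d ∣ n → (y d : ZMod n) = u d) :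
    (∀ d (h : d ∣ n), ZMod.unitsMap h (moebiusProd _ d u) = 1) ↔ DoldCongruences n y := by
  have key (p : ℕ) (hp : p.Prime) := divisorSum_mem_iff (M := Additive (ZMod n)ˣ)
    (c := fun e => moebius e) (r := 0) hp (by simp)
    (fun e he => by rw [moebius_prime_mul_of_dvd hp he, zero_mul])
    (fun e he => by rw [moebius_prime_mul_of_not_dvd hp he]; ring)
    (fun k => (congruenceUnits n (p ^ k)).toAddSubgroup) (by
      rw [AddSubgroup.eq_top_iff']
      intro x
      obtain ⟨a, ha⟩ := ZMod.exists_intCast_eq ((x.toMul : (ZMod n)ˣ) : ZMod n)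
      exact (mem_congruenceUnits_iff (by simp) ha).2 (by simp))
    (fun k x _ => by rw [zero_smul]; exact zero_mem _)
    (fun d => Additive.ofMul (u d)) hn
  have hS (d : ℕ) : divisorSum (fun e => moebius e) (fun d => Additive.ofMul (u d)) d =
      Additive.ofMul (moebiusProd _ d u) := rfl
  have hleft (d : ℕ) (h : d ∣ n) : ZMod.unitsMap h (moebiusProd _ d u) = 1 ↔
      ∀ p : ℕ, p.Prime → ∀ k, p ^ k ∣ d → moebiusProd _ d u ∈ congruenceUnits n (p ^ k) := by
    obtain ⟨a, ha⟩ := ZMod.exists_intCast_eq ((moebiusProd _ d u : (ZMod n)ˣ) : ZMod n)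
    rw [← map_one (ZMod.unitsMap h), ZMod.unitsMap_eq_unitsMap_iff h ha (b := 1) (by simp),
      Int.natCast_dvd_iff_prime_pow]
    exact forall₄_congr fun p _ k hk => (mem_congruenceUnits_iff (hk.trans h) ha).symm
  have hright (p d : ℕ) (hd : d ∣ n) (k : ℕ) (hk : p ^ (k + 1) ∣ d) :
      u d / u (d / p) ∈ congruenceUnits n (p ^ (k + 1)) ↔
        ((p ^ (k + 1) : ℕ) : ℤ) ∣ y d - y (d / p) :=
    div_mem_congruenceUnits_iff (hk.trans hd) (hy d hd) (hy _ ((Nat.div_dvd_of_dvd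
      ((dvd_pow_self p k.succ_ne_zero).trans hk)).trans hd))
  rw [forall₂_congr hleft, DoldCongruences]
  constructor
  · intro h p hp d hd k hk
    exact (hright p d hd k hk).1 ((key p hp).1 (fun d hd k hk => h d hd p hp k hk) d hd k hk)
  · intro h d hd p hp k hk
    exact (key p hp).2 (fun d hd k hk => (hright p d hd k hk).2 (h p hp d hd k hk)) d hd k hk

/-- The Möbius transform, with values at `d` reduced modulo `d`, is surjective, and remains so
when restricted to any subgroup. -/
theorem exists_unitsMap_moebiusProd_eq {n : ℕ} (hn : n ≠ 0) (H : Subgroup (ZMod n)ˣ)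
    (t : ∀ d, d ∣ n → (ZMod d)ˣ) (ht : ∀ d h, t d h ∈ H.map (ZMod.unitsMap h)) :
    ∃ u : ℕ → (ZMod n)ˣ, (∀ d, u d ∈ H) ∧
      ∀ d h, ZMod.unitsMap h (moebiusProd _ d u) = t d h := by
  choose s hs hst using ht
  refine ⟨fun k => ∏ i ∈ k.divisors, if h : i ∣ n then s i h else 1,
    fun d => prod_mem fun i _ => ?_, fun d h => ?_⟩
  · split_ifs
    exacts [hs _ _, one_mem _]
  · rw [moebiusProd_prod_divisors _ (Nat.pos_of_dvd_of_pos h (Nat.pos_of_ne_zero hn)), dif_pos h,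
      hst]

/-- The Möbius transform modulo signs, indexed by the divisors `d ≠ 1, 2` of `n`. -/
def moebiusModSigns (n : ℕ) : (ℕ → (ZMod n)ˣ) →*
    ((d : {d : ℕ // d ∈ n.divisors ∧ d ≠ 1 ∧ d ≠ 2}) →
      (ZMod (d : ℕ))ˣ ⧸ Subgroup.closure {(-1 : (ZMod (d : ℕ))ˣ)}) :=
  MonoidHom.pi fun d => (QuotientGroup.mk' _).comp
    ((ZMod.unitsMap (Nat.dvd_of_mem_divisors d.2.1)).comp (moebiusProd _ d))

theorem moebiusModSigns_surjective {n : ℕ} (hn : n ≠ 0) :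
    Function.Surjective (moebiusModSigns n) := by
  have : NeZero n := ⟨hn⟩
  intro t
  choose s hs using fun d => QuotientGroup.mk'_surjective _ (t d)
  obtain ⟨u, -, hu⟩ := exists_unitsMap_moebiusProd_eq hn ⊤
    (fun d h => if hd : d ≠ 1 ∧ d ≠ 2 then s ⟨d, Nat.mem_divisors.2 ⟨h, hn⟩, hd⟩ else 1)
    (fun d h => by
      obtain ⟨a, ha⟩ := ZMod.unitsMap_surjective h
        (if hd : d ≠ 1 ∧ d ≠ 2 then s ⟨d, Nat.mem_divisors.2 ⟨h, hn⟩, hd⟩ else 1)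
      exact ⟨a, trivial, ha⟩)
  refine ⟨u, funext fun d => ?_⟩
  rw [← hs d]
  change QuotientGroup.mk' _ (ZMod.unitsMap _ (moebiusProd _ d u)) = _
  rw [hu, dif_pos d.2.2]

theorem mem_ker_moebiusModSigns_iff {n : ℕ} (hn : n ≠ 0) (u : ℕ → (ZMod n)ˣ) :
    u ∈ (moebiusModSigns n).ker ↔ ∃ v : ℕ → (ZMod n)ˣ, (∀ d, v d ∈ Subgroup.closure {-1}) ∧
      ∀ d (h : d ∣ n), ZMod.unitsMap h (moebiusProd _ d (u / v)) = 1 := by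
  have hmap (d : ℕ) (h : d ∣ n) : (Subgroup.closure {(-1 : (ZMod n)ˣ)}).map (ZMod.unitsMap h) =
      Subgroup.closure {-1} := by
    rw [MonoidHom.map_closure, Set.image_singleton]
    congr 2
    ext
    simp [ZMod.unitsMap_val, ZMod.cast_neg h, ZMod.cast_one h]
  have hker : u ∈ (moebiusModSigns n).ker ↔ ∀ d (h : d ∣ n),
      ZMod.unitsMap h (moebiusProd _ d u) ∈ Subgroup.closure {-1} := by
    rw [MonoidHom.mem_ker, funext_iff]
    constructor
    · intro hu d h
      by_cases hd : d ≠ 1 ∧ d ≠ 2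
      · exact (QuotientGroup.eq_one_iff _).1 (hu ⟨d, Nat.mem_divisors.2 ⟨h, hn⟩, hd⟩)
      · have : Subsingleton (ZMod d)ˣ := by
          obtain rfl | rfl : d = 1 ∨ d = 2 := by tauto
          all_goals exact ⟨by decide⟩
        rw [Subsingleton.elim (ZMod.unitsMap h (moebiusProd _ d u)) 1]
        exact one_mem _
    · exact fun hu d => (QuotientGroup.eq_one_iff _).2 (hu d (Nat.dvd_of_mem_divisors d.2.1))
  rw [hker]
  constructor
  · intro h
    obtain ⟨v, hv, hvu⟩ := exists_unitsMap_moebiusProd_eq hn (Subgroup.closure {-1})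
      (fun d hd => ZMod.unitsMap hd (moebiusProd _ d u)) (fun d hd => by rw [hmap]; exact h d hd)
    exact ⟨v, hv, fun d hd => by rw [map_div, map_div, hvu, div_self']⟩
  · rintro ⟨v, hv, huv⟩ d h
    have := huv d h
    rw [map_div, map_div, div_eq_one] at this
    rw [this, ← hmap d h, moebiusProd_apply]
    exact Subgroup.mem_map_of_mem _ (prod_mem fun e _ => zpow_mem (hv _) _)

end UnitCongruences

section PrincipalIdealRing

open CommRing

/-- The Picard group of a principal ideal ring is trivial. -/
theorem CommRing.Pic.subsingleton_of_isPrincipalIdealRing (R : Type*) [CommRing R]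
    [IsPrincipalIdealRing R] : Subsingleton (Pic R) := by
  refine Pic.subsingleton_iff.2 fun M _ _ _ => ?_
  obtain ⟨I, ⟨e⟩⟩ := Module.Invertible.exists_linearEquiv_ideal R M
  obtain ⟨a, ha⟩ := (IsPrincipalIdealRing.principal I).principal
  have haI : a ∈ I := ha ▸ Submodule.mem_span_singleton_self a
  let g : R →ₗ[R] M := LinearMap.toSpanSingleton R M (e.symm ⟨a, haI⟩)
  have hg : Function.Surjective g := by
    intro m
    have hm : (e m : R) ∈ Submodule.span R {a} := ha ▸ (e m).2
    obtain ⟨r, hr⟩ := Submodule.mem_span_singleton.1 hm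
    refine ⟨r, ?_⟩
    rw [LinearMap.toSpanSingleton_apply, ← map_smul, LinearEquiv.symm_apply_eq]
    exact Subtype.ext hr
  exact .of_equiv (LinearEquiv.ofBijective g (Module.Invertible.bijective_of_surjective hg))

end PrincipalIdealRing

section Conductor

open CommRing

variable {R A : Type*} [CommRing R] [CommRing A] [Algebra R A] {Q : Type*} [CommRing Q]

/-- Let `f : A → Q` be a surjective ring homomorphism whose kernel lies in the image of `R`. A unit
`u` of `Q` defines the invertible `R`-submodule of `A` of those elements whose image in `Q` lies
in `u` times the image of `R`. -/
def unitSubmodule (f : A →+* Q) (hf : Function.Surjective f)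
    (hker : ∀ a, f a = 0 → ∃ r, algebraMap R A r = a) : Qˣ →* Submodule R A where
  toFun u :=
    { carrier := {a | ∃ r : R, f a = u * f (algebraMap R A r)}
      zero_mem' := ⟨0, by simp⟩
      add_mem' := by
        rintro a b ⟨r, hr⟩ ⟨s, hs⟩
        exact ⟨r + s, by simp only [map_add, hr, hs, mul_add]⟩
      smul_mem' := by
        rintro c a ⟨r, hr⟩
        exact ⟨c * r, by simp only [Algebra.smul_def, map_mul, hr]; ring⟩ }
  map_one' := by
    ext a
    rw [Submodule.mem_one]
    constructor
    · rintro ⟨r, hr⟩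
      obtain ⟨s, hs⟩ := hker (a - algebraMap R A r) (by rw [map_sub, hr]; simp)
      exact ⟨s + r, by rw [map_add, hs, sub_add_cancel]⟩
    · rintro ⟨r, rfl⟩
      exact ⟨r, by simp⟩
  map_mul' u v := by
    apply le_antisymm
    · rintro w ⟨r, hr⟩
      obtain ⟨a, ha⟩ := hf u
      obtain ⟨b, hb⟩ := hf v
      obtain ⟨c, hc⟩ := hf (v⁻¹ : Qˣ)
      have hzero {z : A} (hz : f z = 0) (u : Qˣ) : ∃ r : R, f z = u * f (algebraMap R A r) :=
        ⟨0, by simp [hz]⟩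
      have hmul : r • a * b + (w - r • a * b) * c * b +
          (w - r • a * b) * (1 - c * b) = w := by ring
      have hw : f (w - r • a * b) = 0 := by
        simp only [map_sub, map_mul, Algebra.smul_def, hr, ha, hb, Units.val_mul]; ring
      rw [← hmul]
      refine add_mem (add_mem (Submodule.mul_mem_mul ?_ ?_) (Submodule.mul_mem_mul ?_ ?_))
        (Submodule.mul_mem_mul ?_ ?_)
      · exact ⟨r, by simp only [Algebra.smul_def, map_mul, ha]; ring⟩
      · exact ⟨1, by simp [hb]⟩
      · exact hzero (by rw [map_mul, hw, zero_mul]) u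
      · exact ⟨1, by simp [hb]⟩
      · exact hzero hw u
      · exact hzero (by simp [hb, hc]) v
    · rw [Submodule.mul_le]
      rintro a ⟨r, hr⟩ b ⟨s, hs⟩
      exact ⟨r * s, by simp only [map_mul, hr, hs, Units.val_mul]; ring⟩

variable (f : A →+* Q) (hf : Function.Surjective f)
  (hker : ∀ a, f a = 0 → ∃ r, algebraMap R A r = a)

theorem mem_unitSubmodule {u : Qˣ} {a : A} :
    a ∈ unitSubmodule f hf hker u ↔ ∃ r : R, f a = u * f (algebraMap R A r) := Iff.rfl

/-- Units of `Q` that come from a product of a unit of `A` and an element of `R` are exactly those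
whose associated submodule is principal. -/
theorem exists_span_singleton_eq_unitSubmodule_iff [Finite Q] (u : Qˣ) :
    (∃ x : Aˣ, Submodule.span R {(x : A)} = unitSubmodule f hf hker u) ↔
      ∃ (x : Aˣ) (r : R), (u : Q) = f x * f (algebraMap R A r) := by
  constructor
  · rintro ⟨x, hx⟩
    obtain ⟨a, ha⟩ := hf u
    have hmem : a ∈ unitSubmodule f hf hker u := ⟨1, by simp [ha]⟩
    rw [← hx, Submodule.mem_span_singleton] at hmem
    obtain ⟨r, hr⟩ := hmem
    exact ⟨x, r, by rw [← ha, ← hr, Algebra.smul_def, map_mul, mul_comm]⟩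
  · rintro ⟨x, r, hu⟩
    refine ⟨x, le_antisymm ?_ ?_⟩
    · rw [Submodule.span_singleton_le_iff_mem]
      have hr : IsUnit (f (algebraMap R A r)) := isUnit_of_mul_isUnit_right (hu ▸ u.isUnit)
      obtain ⟨w, hw⟩ := hr
      obtain ⟨k, hk, hwk⟩ := (isOfFinOrder_of_finite w).exists_pow_eq_one
      obtain ⟨k, rfl⟩ := Nat.exists_eq_succ_of_ne_zero hk.ne'
      refine ⟨r ^ k, ?_⟩
      rw [map_pow, map_pow, hu, mul_assoc, ← hw, ← pow_succ', ← Units.val_pow_eq_pow_val, hwk,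
        Units.val_one, mul_one]
    · rintro a ⟨s, hs⟩
      obtain ⟨t, ht⟩ := hker (a * (x⁻¹ : Aˣ) - algebraMap R A (r * s)) (by
        have hx : f x * f (x⁻¹ : Aˣ) = 1 := by rw [← map_mul, Units.mul_inv, map_one]
        rw [map_sub, map_mul, hs, hu, map_mul, map_mul]
        linear_combination f (algebraMap R A r) * f (algebraMap R A s) * hx)
      refine Submodule.mem_span_singleton.2 ⟨t + r * s, ?_⟩
      rw [Algebra.smul_def, map_add, ht, sub_add_cancel, mul_assoc, Units.inv_mul, mul_one]

open TensorProduct in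
/-- An invertible module is generated by one element modulo an ideal with finite quotient. -/
theorem Module.Invertible.exists_forall_sub_smul_mem (J : Ideal R) [Finite (R ⧸ J)]
    (M : Type*) [AddCommGroup M] [Module R M] [Module.Invertible R M] :
    ∃ x : M, ∀ z : M, ∃ r : R, z - r • x ∈ J • (⊤ : Submodule R M) := by
  obtain ⟨e⟩ := Module.Invertible.free_iff_linearEquiv.1
    (inferInstance : Module.Free (R ⧸ J) ((R ⧸ J) ⊗[R] M))
  let e' := (e.restrictScalars R).symm ≪≫ₗ quotTensorEquivQuotSMul M J
  obtain ⟨x, hx⟩ := Submodule.Quotient.mk_surjective _ (e' 1)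
  refine ⟨x, fun z => ?_⟩
  obtain ⟨r, hr⟩ := Ideal.Quotient.mk_surjective (e'.symm (Submodule.Quotient.mk z))
  refine ⟨r, ?_⟩
  rw [← Submodule.Quotient.eq, Submodule.Quotient.mk_smul, hx, ← map_smul,
    ← LinearEquiv.symm_apply_eq, ← hr, Algebra.smul_def, mul_one]
  rfl

theorem exists_unitSubmodule_eq [FaithfulSMul R A] [Finite Q] (I : (Submodule R A)ˣ) :
    ∃ u, unitSubmodule f hf hker u = I := by
  let J : Ideal R := RingHom.ker (f.comp (algebraMap R A))
  have : Finite (R ⧸ J) := .of_injective _ (RingHom.kerLift_injective (f.comp (algebraMap R A)))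
  obtain ⟨x, hx⟩ := Module.Invertible.exists_forall_sub_smul_mem J I.1
  have hJ (z : I.1) (hz : z ∈ J • (⊤ : Submodule R I.1)) : f z = 0 := by
    induction hz using Submodule.smul_induction_on' with
    | smul r hr z _ =>
      have hr : f (algebraMap R A r) = 0 := hr
      rw [Submodule.coe_smul, Algebra.smul_def, map_mul, hr, zero_mul]
    | add y _ z _ hy hz => rw [Submodule.coe_add, map_add, hy, hz, add_zero]
  have hgen (z : A) (hz : z ∈ I.1) : ∃ r : R, f z = f x * f (algebraMap R A r) := by
    obtain ⟨r, hr⟩ := hx ⟨z, hz⟩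
    have := hJ _ hr
    rw [AddSubgroupClass.coe_sub, Submodule.coe_smul, Algebra.smul_def, map_sub, map_mul,
      sub_eq_zero] at this
    exact ⟨r, by rw [mul_comm]; exact this⟩
  have hone : (1 : A) ∈ ⊤ * I.1 := by
    rw [Submodule.top_mul_eq_top_of_mul_eq_one I.inv_mul]; trivial
  have hdvd : ∀ w ∈ ⊤ * I.1, f x ∣ f w := by
    intro w hw
    induction hw using Submodule.mul_induction_on' with
    | mem_mul_mem a _ z hz =>
      obtain ⟨r, hr⟩ := hgen z hz
      exact ⟨f a * f (algebraMap R A r), by rw [map_mul, hr]; ring⟩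
    | add a _ b _ ha hb => rw [map_add]; exact dvd_add ha hb
  have hmul : ∀ t, f t = 0 → ∀ w ∈ ⊤ * I.1, t * w ∈ I.1 := by
    intro t ht w hw
    induction hw using Submodule.mul_induction_on' with
    | mem_mul_mem a _ z hz =>
      obtain ⟨r, hr⟩ := hker (t * a) (by rw [map_mul, ht, zero_mul])
      rw [← mul_assoc, ← hr, ← Algebra.smul_def]
      exact I.1.smul_mem r hz
    | add a _ b _ ha hb => rw [mul_add]; exact add_mem ha hb
  obtain ⟨u, hu⟩ := isUnit_of_dvd_one (map_one f ▸ hdvd 1 hone)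
  refine ⟨u, le_antisymm ?_ fun z hz => (mem_unitSubmodule f hf hker).2 (hu ▸ hgen z hz)⟩
  rintro a ⟨r, hr⟩
  have := hmul (a - r • (x : A)) (by
    rw [map_sub, hr, hu, Algebra.smul_def, map_mul]; ring) 1 hone
  rw [mul_one] at this
  rw [← sub_add_cancel a (r • (x : A))]
  exact add_mem this (I.1.smul_mem r x.2)

variable (R) in
/-- The connecting homomorphism from the units of `Q` to the Picard group of `R`. -/
noncomputable def unitsToPicOfConductor [FaithfulSMul R A] : Qˣ →* Pic R :=
  (Submodule.unitsToPic R A).comp (unitSubmodule f hf hker).toHomUnits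

theorem unitsToPicOfConductor_surjective [FaithfulSMul R A] [Finite Q] [Subsingleton (Pic A)] :
    Function.Surjective (unitsToPicOfConductor R f hf hker) := by
  intro M
  have hM : M ∈ (Submodule.unitsToPic R A).range := by
    rw [Submodule.range_unitsToPic, relPic_eq_top]
    trivial
  obtain ⟨I, rfl⟩ := hM
  obtain ⟨u, hu⟩ := exists_unitSubmodule_eq f hf hker I
  exact ⟨u, congrArg (Submodule.unitsToPic R A) (Units.ext hu)⟩

theorem mem_ker_unitsToPicOfConductor_iff [FaithfulSMul R A] [Finite Q] (u : Qˣ) :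
    u ∈ (unitsToPicOfConductor R f hf hker).ker ↔
      ∃ (x : Aˣ) (r : R), (u : Q) = f x * f (algebraMap R A r) := by
  rw [← exists_span_singleton_eq_unitSubmodule_iff f hf hker, unitsToPicOfConductor,
    MonoidHom.mem_ker, MonoidHom.comp_apply, ← MonoidHom.mem_ker, Submodule.ker_unitsToPic]
  exact exists_congr fun x => Units.ext_iff

/-- The Picard group of `R` is isomorphic to `H` as soon as some group maps onto both `Qˣ` and `H`
in such a way that the kernel of the map to `H` is the preimage of `f (Aˣ) * f R`. -/
noncomputable def picMulEquivOfConductor [FaithfulSMul R A] [Finite Q] [Subsingleton (Pic A)]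
    {G H : Type*} [Group G] [Group H]
    (g : G →* Qˣ) (hg : Function.Surjective g) (h : G →* H) (hh : Function.Surjective h)
    (hgh : ∀ u : G, (∃ (x : Aˣ) (r : R), (g u : Q) = f x * f (algebraMap R A r)) ↔ u ∈ h.ker) :
    Pic R ≃* H :=
  (QuotientGroup.quotientKerEquivOfSurjective ((unitsToPicOfConductor R f hf hker).comp g)
      ((unitsToPicOfConductor_surjective f hf hker).comp hg)).symm.trans <|
    (QuotientGroup.quotientMulEquivOfEq <| Subgroup.ext fun u =>
      (mem_ker_unitsToPicOfConductor_iff f hf hker (g u)).trans (hgh u)).trans <|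
    QuotientGroup.quotientKerEquivOfSurjective h hh

end Conductor

section RingPic

/-- `RingPic R` is isomorphic to the Picard group of `R` in Mathlib. -/
noncomputable def RingPic.equivPic (R : Type) [CommRing R] : RingPic R ≃* CommRing.Pic R :=
  (Units.mapEquiv (Skeleton.mulEquiv ModuleCat.equivalenceSemimoduleCat)).trans
    Shrink.mulEquiv.symm

end RingPic

section BurnsideRing

/-- Coordinatewise reduction modulo `n` of integer functions on the divisors of `n`. -/
def reduceMod (n : ℕ) : ({m : ℕ // m ∈ n.divisors} → ℤ) →+* ({m : ℕ // m ∈ n.divisors} → ZMod n) :=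
  (Int.castRingHom (ZMod n)).compLeft _

theorem reduceMod_apply {n : ℕ} (x : {m : ℕ // m ∈ n.divisors} → ℤ)
    (m : {m : ℕ // m ∈ n.divisors}) : reduceMod n x m = (x m : ZMod n) := rfl

theorem reduceMod_surjective (n : ℕ) : Function.Surjective (reduceMod n) :=
  ZMod.intCast_surjective.comp_left

theorem mem_burnsideSet_of_reduceMod_eq_zero {n : ℕ} {x : {m : ℕ // m ∈ n.divisors} → ℤ}
    (hx : reduceMod n x = 0) : x ∈ BurnsideSet n := by
  intro d hd
  refine dvd_sum fun e _ => Dvd.dvd.mul_left ?_ _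
  exact (Int.natCast_dvd_natCast.2 (Nat.dvd_of_mem_divisors hd)).trans
    ((ZMod.intCast_zmod_eq_zero_iff_dvd _ _).1 (congrFun hx _))

/-- Restriction of a sequence of units modulo `n` to the divisors of `n`, reindexed by
complementary divisors. -/
def restrictUnits (n : ℕ) : (ℕ → (ZMod n)ˣ) →* ({m : ℕ // m ∈ n.divisors} → ZMod n)ˣ :=
  MulEquiv.piUnits.symm.toMonoidHom.comp
    (MonoidHom.pi fun m : {m : ℕ // m ∈ n.divisors} => Pi.evalMonoidHom _ (n / (m : ℕ)))

theorem restrictUnits_apply {n : ℕ} (u : ℕ → (ZMod n)ˣ) (m : {m : ℕ // m ∈ n.divisors}) :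
    (restrictUnits n u : {m : ℕ // m ∈ n.divisors} → ZMod n) m = u (n / m) := rfl

theorem restrictUnits_surjective (n : ℕ) : Function.Surjective (restrictUnits n) := by
  intro w
  refine ⟨complementaryExtension (MulEquiv.piUnits w), Units.ext (funext fun m => ?_)⟩
  rw [restrictUnits_apply, complementaryExtension_div]
  rfl

theorem exists_restrictUnits_eq_mul_iff {n : ℕ} (hn : n ≠ 0) (u : ℕ → (ZMod n)ˣ) :
    (∃ (x : ({m : ℕ // m ∈ n.divisors} → ℤ)ˣ), ∃ b ∈ BurnsideSet n,
      (restrictUnits n u : {m : ℕ // m ∈ n.divisors} → ZMod n) =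
        reduceMod n x * reduceMod n b) ↔
      u ∈ (moebiusModSigns n).ker := by
  let sign : ℤˣ →* (ZMod n)ˣ := Units.map (Int.castRingHom (ZMod n))
  have hsign : sign (-1) = -1 := by ext; simp [sign]
  rw [mem_ker_moebiusModSigns_iff hn]
  constructor
  · rintro ⟨x, b, hb, hu⟩
    let ε := complementaryExtension (MulEquiv.piUnits x)
    refine ⟨fun d => sign (ε d), fun d => ?_, ?_⟩
    · change sign (ε d) ∈ Subgroup.closure {-1}
      rcases Int.units_eq_one_or (ε d) with h | h
      · rw [h, map_one]
        exact one_mem _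
      · rw [h, hsign]
        exact Subgroup.mem_closure_singleton_self _
    · refine (forall_unitsMap_moebiusProd_eq_one_iff hn _ _ fun d hd => ?_).2
        ((mem_burnsideSet_iff_s5 hn b).1 hb)
      obtain ⟨m, rfl⟩ := exists_eq_div_of_dvd hn hd
      have hm := congrFun hu m
      rw [restrictUnits_apply, Pi.mul_apply, reduceMod_apply, reduceMod_apply] at hm
      have hx : ((sign (ε (n / m)) : (ZMod n)ˣ) : ZMod n) = (x.1 m : ℤ) := by
        simp only [ε, complementaryExtension_div]
        rfl
      rw [complementaryExtension_div, ← (sign (ε (n / m))).isUnit.mul_right_inj, hx, ← hm, ← hx,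
        ← Units.val_mul, Pi.div_apply, mul_div_cancel]
  · rintro ⟨v, hv, huv⟩
    have hv' (d : ℕ) : ∃ ε : ℤˣ, sign ε = v d := by
      obtain ⟨k, hk⟩ := Subgroup.mem_closure_singleton.1 (hv d)
      exact ⟨(-1) ^ k, by rw [map_zpow, hsign, hk]⟩
    choose ε hε using hv'
    choose y hy using fun d => ZMod.exists_intCast_eq (((u / v) d : (ZMod n)ˣ) : ZMod n)
    let b : {m : ℕ // m ∈ n.divisors} → ℤ := fun m => y (n / m)
    refine ⟨MulEquiv.piUnits.symm fun m => ε (n / m), b, ?_, funext fun m => ?_⟩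
    · rw [mem_burnsideSet_iff_s5 hn]
      refine (forall_unitsMap_moebiusProd_eq_one_iff hn _ _ fun d hd => ?_).1 huv
      obtain ⟨m, rfl⟩ := exists_eq_div_of_dvd hn hd
      rw [complementaryExtension_div]
      exact hy _
    · have hx : ((v (n / m) : (ZMod n)ˣ) : ZMod n) = ((ε (n / m) : ℤ) : ZMod n) := by
        rw [← hε]
        rfl
      rw [restrictUnits_apply, Pi.mul_apply, reduceMod_apply, reduceMod_apply, hy]
      change _ = ((ε (n / m) : ℤ) : ZMod n) * _
      rw [← hx, ← Units.val_mul, Pi.div_apply, mul_div_cancel]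

end BurnsideRing

/-- Let `n` be a positive integer and let `B` be the subring of
`∏_{m ∣ n} ℤ` whose underlying set is `B_n` (so `B ≅ A(C_n)`, the Burnside ring of `C_n`).
Then the Picard group of `B` is isomorphic to the product over the divisors `d` of `n` with
`d ≠ 1, 2` of the groups `(ℤ/d)ˣ/{±1}`, where `{±1}` is the subgroup generated by `-1`. -/
theorem pic_burnside (n : ℕ) (hn : 0 < n)
    (B : Subring ({m : ℕ // m ∈ n.divisors} → ℤ)) (hB : (B : Set _) = BurnsideSet n) :
    Nonempty (RingPic B ≃*
      ((d : {d : ℕ // d ∈ n.divisors ∧ d ≠ 1 ∧ d ≠ 2}) →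
        (ZMod (d : ℕ))ˣ ⧸ Subgroup.closure {(-1 : (ZMod (d : ℕ))ˣ)})) := by
  have hn0 : n ≠ 0 := hn.ne'
  have : NeZero n := ⟨hn0⟩
  have := CommRing.Pic.subsingleton_of_isPrincipalIdealRing ({m : ℕ // m ∈ n.divisors} → ℤ)
  have hmem (x : {m : ℕ // m ∈ n.divisors} → ℤ) : x ∈ B ↔ x ∈ BurnsideSet n := by
    rw [← hB, SetLike.mem_coe]
  have hker (a : {m : ℕ // m ∈ n.divisors} → ℤ) (ha : reduceMod n a = 0) :
      ∃ r : B, algebraMap B _ r = a :=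
    ⟨⟨a, (hmem a).2 (mem_burnsideSet_of_reduceMod_eq_zero ha)⟩, rfl⟩
  have : FaithfulSMul B ({m : ℕ // m ∈ n.divisors} → ℤ) :=
    (faithfulSMul_iff_algebraMap_injective _ _).2 Subtype.val_injective
  have hgh (u : ℕ → (ZMod n)ˣ) :
      (∃ (x : ({m : ℕ // m ∈ n.divisors} → ℤ)ˣ) (r : B),
        (restrictUnits n u : {m : ℕ // m ∈ n.divisors} → ZMod n) =
          reduceMod n x * reduceMod n (algebraMap B _ r)) ↔ u ∈ (moebiusModSigns n).ker := by
    rw [← exists_restrictUnits_eq_mul_iff hn0]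
    exact exists_congr fun x => ⟨fun ⟨r, hr⟩ => ⟨r, (hmem r).1 r.2, hr⟩,
      fun ⟨b, hb, h⟩ => ⟨⟨b, (hmem b).2 hb⟩, h⟩⟩
  exact ⟨(RingPic.equivPic B).trans <|
    picMulEquivOfConductor (reduceMod n) (reduceMod_surjective n) hker
      (restrictUnits n) (restrictUnits_surjective n)
      (H := (d : {d : ℕ // d ∈ n.divisors ∧ d ≠ 1 ∧ d ≠ 2}) →
        (ZMod (d : ℕ))ˣ ⧸ Subgroup.closure {(-1 : (ZMod (d : ℕ))ˣ)})
      (moebiusModSigns n) (moebiusModSigns_surjective hn0) hgh⟩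
end

section
/- Let n be a positive integer. The Picard group of the commutative ring B_n is a finite group. -/
open Finset

open CategoryTheory

/-- The Picard group of a principal ideal ring is trivial. -/
theorem subsingleton_pic_of_isPrincipalIdealRing (A : Type*) [CommRing A]
    [IsPrincipalIdealRing A] : Subsingleton (CommRing.Pic A) := by
  refine CommRing.Pic.subsingleton_iff.mpr fun M _ _ _ ↦ ?_
  obtain ⟨I, ⟨e⟩⟩ := Module.Invertible.exists_linearEquiv_ideal A M
  obtain ⟨a, rfl⟩ := IsPrincipalIdealRing.principal I
  have := Module.Invertible.congr e
  have hf : Function.Surjective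
      (LinearMap.toSpanSingleton A (Submodule.span A {a})
        ⟨a, Submodule.mem_span_singleton_self a⟩) := by
    rintro ⟨x, hx⟩
    obtain ⟨r, rfl⟩ := Submodule.mem_span_singleton.mp hx
    exact ⟨r, rfl⟩
  exact Module.Invertible.free_iff_linearEquiv.mpr ⟨e ≪≫ₗ
    (LinearEquiv.ofBijective _ (Module.Invertible.bijective_of_surjective hf)).symm⟩

/-- If a `B`-submodule `I` of `A` generates `A` as an `A`-module, then it contains every ideal of
`A` contained in `B`. -/
theorem Submodule.mem_of_top_mul_eq_top {A : Type*} [CommRing A] {B : Subring A} {J : Ideal A}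
    (hJ : ∀ x ∈ J, x ∈ B) {I : Submodule B A} (hI : ⊤ * I = ⊤) {x : A} (hx : x ∈ J) :
    x ∈ I := by
  have key : ∀ y ∈ ⊤ * I, x * y ∈ I := by
    intro y hy
    induction hy using Submodule.mul_induction_on' with
    | mem_mul_mem a _ b hb =>
      have := I.smul_mem ⟨x * a, hJ _ (J.mul_mem_right a hx)⟩ hb
      rwa [Subring.smul_def, smul_eq_mul, mul_assoc] at this
    | add y _ z _ hy hz => rw [mul_add]; exact I.add_mem hy hz
  simpa using key 1 (by rw [hI]; exact Submodule.mem_top)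

/-- If `B` is a subring of a ring `A` with trivial Picard group and `B` contains an ideal of `A`
with finite quotient, then `B` has finite Picard group. -/
theorem finite_ringPic_of_ker_le {A : Type} [CommRing A] [Subsingleton (CommRing.Pic A)]
    {C : Type*} [Ring C] [Finite C] (f : A →+* C) (B : Subring A)
    (hf : ∀ x ∈ RingHom.ker f, x ∈ B) : Finite (RingPic B) := by
  have embed (M : (Skeleton (ModuleCat.{0} B))ˣ) :
      ∃ I : Submodule B A, ⊤ * I = ⊤ ∧ Nonempty (I ≃ₗ[B] M.val) := by
    obtain ⟨e⟩ := Module.Invertible.free_iff_linearEquiv.mp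
      (inferInstance : Module.Free A (TensorProduct B A M.val))
    exact ⟨_, Module.Flat.top_mul_submoduleAlgebra e, ⟨Module.Flat.submoduleAlgebraEquiv e⟩⟩
  choose I hI e using embed
  have le {M N} (h : f '' (I M : Set A) = f '' (I N : Set A)) : I M ≤ I N := by
    intro x hx
    obtain ⟨y, hy, hxy⟩ := h ▸ Set.mem_image_of_mem f hx
    have : x - y ∈ I N := Submodule.mem_of_top_mul_eq_top hf (hI N)
      (by rw [RingHom.mem_ker, map_sub, hxy, sub_self])
    simpa using (I N).add_mem this hy
  refine Finite.of_injective (β := Set C) (fun M ↦ f '' (I M : Set A)) fun M N h ↦ ?_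
  have hMN : I M = I N := le_antisymm (le h) (le h.symm)
  exact Units.ext <| Quotient.out_equiv_out.mp
    ⟨((e M).some.symm ≪≫ₗ LinearEquiv.ofEq _ _ hMN ≪≫ₗ (e N).some).toModuleIso⟩

/-- Let `n` be a positive integer and let `B` be the subring of
`∏_{m ∣ n} ℤ` whose underlying set is `B_n` (so `B ≅ A(C_n)`, the Burnside ring of `C_n`).
Then the Picard group of the commutative ring `B` is a finite group. -/
theorem pic_burnside_finite (n : ℕ) (hn : 0 < n)
    (B : Subring ({m : ℕ // m ∈ n.divisors} → ℤ)) (hB : (B : Set _) = BurnsideSet n) :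
    Finite (RingPic B) := by
  have : NeZero n := ⟨hn.ne'⟩
  have := subsingleton_pic_of_isPrincipalIdealRing ({m : ℕ // m ∈ n.divisors} → ℤ)
  refine finite_ringPic_of_ker_le
    (RingHom.pi fun i ↦ (Int.castRingHom (ZMod n)).comp (Pi.evalRingHom _ i)) B fun x hx ↦ ?_
  have hdvd (i) : (n : ℤ) ∣ x i :=
    (ZMod.intCast_zmod_eq_zero_iff_dvd _ _).mp (congrFun (RingHom.mem_ker.mp hx) i)
  rw [← SetLike.mem_coe, hB]
  exact fun d hd ↦ Finset.dvd_sum fun e _ ↦ dvd_mul_of_dvd_right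
    ((Int.natCast_dvd_natCast.mpr (Nat.dvd_of_mem_divisors hd)).trans (hdvd _)) _
end
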